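/- arXiv:2501.03270 — 5 statements merged into one kernel-verified Lean document; each statement's English description precedes it below -/
import Mathlib

section
/- For λ > 0 let s(t) = exp(−λ/W(μt)). Then for every c > 0, q(ct; s(t))/q(t) → (c + λ^{−γ})^{−α/γ} as t → ∞. -/
open Filter MeasureTheory Real Topology in
/-- If `f (k x) / f x → r`, then the primitive `V` of `f` satisfies `V (k x) / V x → k r`,
provided that `V` tends to infinity. -/
lemma tendsto_primitive_comp_mul_div {f V : ℝ → ℝ} {k r : ℝ} (hk : 0 < k)
    (hf : ContinuousOn f (Set.Ici 1)) (hfpos : ∀ x ∈ Set.Ici (1 : ℝ), 0 < f x)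
    (hV : ∀ x ∈ Set.Ici (1 : ℝ), V x = ∫ u in (1 : ℝ)..x, f u)
    (hVtop : Tendsto V atTop atTop)
    (hr : Tendsto (fun x => f (k * x) / f x) atTop (𝓝 r)) :
    Tendsto (fun x => V (k * x) / V x) atTop (𝓝 (k * r)) := by
  have hint : ∀ a b : ℝ, 1 ≤ a → 1 ≤ b → IntervalIntegrable f volume a b := fun a b ha hb =>
    (hf.mono fun x hx => (le_min ha hb).trans hx.1).intervalIntegrable
  have hVsub : ∀ a b : ℝ, 1 ≤ a → 1 ≤ b → V b - V a = ∫ u in a..b, f u := fun a b ha hb => by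
    rw [hV a ha, hV b hb]
    exact intervalIntegral.integral_interval_sub_left (hint 1 b le_rfl hb) (hint 1 a le_rfl ha)
  rw [Metric.tendsto_atTop]
  intro ε hε
  have hδ : 0 < ε / 2 / k := by positivity
  obtain ⟨N, hN⟩ := Metric.tendsto_atTop.1 hr _ hδ
  set x₀ := max N (max 1 (1 / k)) with hx₀
  have hx₀N : N ≤ x₀ := le_max_left _ _
  have hx₀1 : 1 ≤ x₀ := (le_max_left _ _).trans (le_max_right _ _)
  have hkx : ∀ x, x₀ ≤ x → 1 ≤ k * x := fun x hx => by
    have : 1 / k ≤ x := ((le_max_right _ _).trans (le_max_right _ _)).trans hx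
    rwa [div_le_iff₀' hk] at this
  have hfk : ContinuousOn (fun u => f (k * u)) (Set.Ici x₀) :=
    hf.comp (by fun_prop) fun x hx => hkx x hx
  set C := |V (k * x₀) - k * r * V x₀| + ε / 2 * |V x₀| with hC
  have key : ∀ x, x₀ ≤ x → |V (k * x) - k * r * V x| ≤ C + ε / 2 * V x := by
    intro x hx
    have hx1 : 1 ≤ x := hx₀1.trans hx
    have hik : IntervalIntegrable (fun u => f (k * u)) volume x₀ x :=
      (hfk.mono fun u hu => (le_min le_rfl hx).trans hu.1).intervalIntegrable
    have hi := hint x₀ x hx₀1 hx1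
    have e1 : V (k * x) - V (k * x₀) = k * ∫ u in x₀..x, f (k * u) := by
      rw [hVsub _ _ (hkx x₀ le_rfl) (hkx x hx), intervalIntegral.mul_integral_comp_mul_left]
    have e2 := hVsub x₀ x hx₀1 hx1
    have e3 : V (k * x) - V (k * x₀) - k * r * (V x - V x₀)
        = ∫ u in x₀..x, (k * f (k * u) - k * r * f u) := by
      rw [intervalIntegral.integral_sub (hik.const_mul _) (hi.const_mul _),
        intervalIntegral.integral_const_mul, intervalIntegral.integral_const_mul, e1, e2]
    have e4 : |V (k * x) - V (k * x₀) - k * r * (V x - V x₀)| ≤ ε / 2 * (V x - V x₀) := by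
      rw [e3, e2, ← intervalIntegral.integral_const_mul, ← Real.norm_eq_abs]
      refine intervalIntegral.norm_integral_le_of_norm_le hx ?_ (hi.const_mul _)
      refine Eventually.of_forall fun u hu => ?_
      have hfu := hfpos u (hx₀1.trans hu.1.le)
      have h := (hN u (hx₀N.trans hu.1.le)).le
      rw [Real.dist_eq, le_div_iff₀ hk] at h
      have : k * f (k * u) - k * r * f u = (f (k * u) / f u - r) * k * f u := by
        field_simp
      rw [this, Real.norm_eq_abs, abs_mul, abs_mul, abs_of_pos hk, abs_of_pos hfu]
      gcongr
    have t1 := abs_add_le (V (k * x) - V (k * x₀) - k * r * (V x - V x₀))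
      (V (k * x₀) - k * r * V x₀)
    rw [show V (k * x) - V (k * x₀) - k * r * (V x - V x₀) + (V (k * x₀) - k * r * V x₀)
      = V (k * x) - k * r * V x by ring] at t1
    have t2 := mul_le_mul_of_nonneg_left (neg_le_abs (V x₀)) (half_pos hε).le
    linarith
  have hbig := hVtop.eventually_gt_atTop (max 0 (C / (ε / 2)))
  obtain ⟨M, hM⟩ := eventually_atTop.1 hbig
  refine ⟨max x₀ M, fun x hx => ?_⟩
  have h1 := key x ((le_max_left _ _).trans hx)
  have h2 := hM x ((le_max_right _ _).trans hx)
  have hVpos : 0 < V x := (le_max_left _ _).trans_lt h2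
  have h3 : C / (ε / 2) < V x := (le_max_right _ _).trans_lt h2
  rw [div_lt_iff₀ (half_pos hε)] at h3
  rw [Real.dist_eq, show V (k * x) / V x - k * r = (V (k * x) - k * r * V x) / V x by field_simp,
    abs_div, abs_of_pos hVpos, div_lt_iff₀ hVpos]
  linarith

open Filter Topology in
/-- A monotone function which is regularly varying of index `ρ` at infinity transforms
`a / b → k` with `b → ∞` into `F a / F b → k ^ ρ`. -/
lemma MonotoneOn.tendsto_div_of_regularlyVarying {F a b : ℝ → ℝ} {k ρ : ℝ} (hk : 0 < k)
    (hmono : MonotoneOn F (Set.Ici 1)) (hFtop : Tendsto F atTop atTop)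
    (hF : ∀ c > (0 : ℝ), Tendsto (fun x => F (c * x) / F x) atTop (𝓝 (c ^ ρ)))
    (hb : Tendsto b atTop atTop) (hab : Tendsto (fun t => a t / b t) atTop (𝓝 k)) :
    Tendsto (fun t => F (a t) / F (b t)) atTop (𝓝 (k ^ ρ)) := by
  have hcont : ContinuousAt (fun x : ℝ => x ^ ρ) k := Real.continuousAt_rpow_const _ _ (.inl hk.ne')
  have hFpos : ∀ᶠ t in atTop, 0 < F (b t) := (hFtop.comp hb).eventually_gt_atTop 0
  have hbpos : ∀ᶠ t in atTop, 0 < b t := hb.eventually_gt_atTop 0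
  have hlarge : ∀ c > (0 : ℝ), ∀ᶠ t in atTop, 1 ≤ c * b t := fun c hc =>
    (hb.const_mul_atTop hc).eventually_ge_atTop 1
  rw [tendsto_order]
  refine ⟨fun y hy => ?_, fun y hy => ?_⟩
  · have hev : ∀ᶠ c in 𝓝[<] k, y < c ^ ρ ∧ 0 < c ∧ c < k :=
      ((hcont.eventually (lt_mem_nhds hy)).filter_mono nhdsWithin_le_nhds).and
        (((lt_mem_nhds hk).filter_mono nhdsWithin_le_nhds).and self_mem_nhdsWithin)
    obtain ⟨c, hcy, hc0, hck⟩ := hev.exists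
    filter_upwards [((hF c hc0).comp hb).eventually (lt_mem_nhds hcy), hFpos, hbpos,
      hlarge c hc0, hab.eventually (lt_mem_nhds hck)] with t h1 h2 h3 h4 h5
    rw [lt_div_iff₀ h3] at h5
    exact h1.trans_le
      ((div_le_div_iff_of_pos_right h2).2 (hmono h4 (h4.trans h5.le) h5.le))
  · have hev : ∀ᶠ c in 𝓝[>] k, c ^ ρ < y ∧ k < c :=
      ((hcont.eventually (gt_mem_nhds hy)).filter_mono nhdsWithin_le_nhds).and
        self_mem_nhdsWithin
    obtain ⟨c, hcy, hck⟩ := hev.exists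
    have hk2 : k / 2 < k := half_lt_self hk
    filter_upwards [((hF c (hk.trans hck)).comp hb).eventually (gt_mem_nhds hcy), hFpos, hbpos,
      hlarge _ (half_pos hk), hab.eventually (lt_mem_nhds hk2),
      hab.eventually (gt_mem_nhds hck)] with t h1 h2 h3 h4 h5 h6
    rw [lt_div_iff₀ h3] at h5
    rw [div_lt_iff₀ h3] at h6
    have h7 : 1 ≤ a t := h4.trans h5.le
    exact ((div_le_div_iff_of_pos_right h2).2
      (hmono h7 (h7.trans h6.le) h6.le)).trans_lt h1

open Filter Topology in
/-- If `F` is monotone and regularly varying of positive index `ρ`, then `F a / F b → k ^ ρ`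
with `b → ∞` forces `a / b → k`. -/
lemma MonotoneOn.tendsto_div_of_tendsto_div_regularlyVarying {F a b : ℝ → ℝ} {k ρ : ℝ}
    (hk : 0 < k) (hρ : 0 < ρ)
    (hmono : MonotoneOn F (Set.Ici 1)) (hFtop : Tendsto F atTop atTop)
    (hF : ∀ c > (0 : ℝ), Tendsto (fun x => F (c * x) / F x) atTop (𝓝 (c ^ ρ)))
    (hb : Tendsto b atTop atTop) (ha : ∀ᶠ t in atTop, 1 ≤ a t)
    (hab : Tendsto (fun t => F (a t) / F (b t)) atTop (𝓝 (k ^ ρ))) :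
    Tendsto (fun t => a t / b t) atTop (𝓝 k) := by
  have hFpos : ∀ᶠ t in atTop, 0 < F (b t) := (hFtop.comp hb).eventually_gt_atTop 0
  have hbpos : ∀ᶠ t in atTop, 0 < b t := hb.eventually_gt_atTop 0
  have hlarge : ∀ c > (0 : ℝ), ∀ᶠ t in atTop, 1 ≤ c * b t := fun c hc =>
    (hb.const_mul_atTop hc).eventually_ge_atTop 1
  rw [tendsto_order]
  refine ⟨fun y hy => ?_, fun y hy => ?_⟩
  · rcases le_or_gt y 0 with hy0 | hy0
    · filter_upwards [ha, hbpos] with t h1 h2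
      exact hy0.trans_lt (div_pos (by linarith) h2)
    · filter_upwards [((hF y hy0).comp hb).eventually_lt hab (Real.rpow_lt_rpow hy0.le hy hρ),
        hFpos, hbpos, ha, hlarge y hy0] with t h1 h2 h3 h4 h5
      rw [lt_div_iff₀ h3]
      by_contra! h
      exact h1.not_ge ((div_le_div_iff_of_pos_right h2).2 (hmono h4 h5 h))
  · have hy0 : 0 < y := hk.trans hy
    filter_upwards [hab.eventually_lt ((hF y hy0).comp hb) (Real.rpow_lt_rpow hk.le hy hρ),
      hFpos, hbpos, ha, hlarge y hy0] with t h1 h2 h3 h4 h5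
    rw [div_lt_iff₀ h3]
    by_contra! h
    exact h1.not_ge ((div_le_div_iff_of_pos_right h2).2 (hmono h5 h4 h))

open Filter Topology in
lemma tendsto_one_div_one_sub_exp_div {w : ℝ → ℝ} {lam : ℝ} (hlam : 0 < lam)
    (hw : Tendsto w atTop atTop) :
    Tendsto (fun t => 1 / (1 - Real.exp (-(lam / w t))) / w t) atTop (𝓝 (1 / lam)) := by
  have hd : HasDerivAt (fun y : ℝ => Real.exp (-(lam * y))) (-lam) 0 := by
    have := ((hasDerivAt_id (0 : ℝ)).const_mul lam).neg.exp
    simpa using this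
  have h0 : Tendsto (fun t => (w t)⁻¹) atTop (𝓝[≠] 0) :=
    (tendsto_inv_atTop_nhdsGT_zero.comp hw).mono_right
      (nhdsWithin_mono _ fun x hx => ne_of_gt hx)
  have h1 := ((hd.tendsto_slope_zero.comp h0).neg).inv₀ (by simpa using hlam.ne')
  rw [neg_neg, ← one_div] at h1
  refine h1.congr fun t => ?_
  simp only [Function.comp_apply, inv_inv, zero_add, mul_zero, neg_zero, Real.exp_zero,
    smul_eq_mul, div_eq_mul_inv]
  rw [← mul_neg, neg_sub, mul_inv]
  ring


open Filter MeasureTheory Real in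
theorem stmt1
    (μ γ α : ℝ) (hμ : 0 < μ) (hγ : γ ∈ Set.Ioc (0:ℝ) 1) (hα : α ∈ Set.Ioc (0:ℝ) 1)
    (L l : ℝ → ℝ)
    (hLpos : ∀ x ∈ Set.Ici (1:ℝ), 0 < L x)
    (hLcont : ContinuousOn L (Set.Ici 1))
    (hLsv : ∀ c > (0:ℝ), Filter.Tendsto (fun t => L (c * t) / L t) Filter.atTop (nhds 1))
    (hlsv : ∀ c > (0:ℝ), Filter.Tendsto (fun t => l (c * t) / l t) Filter.atTop (nhds 1))
    (V W : ℝ → ℝ)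
    (hV : ∀ x ∈ Set.Ici (1:ℝ), V x = ∫ u in (1:ℝ)..x, u ^ (γ - 1) / L u)
    (hVtop : Filter.Tendsto V Filter.atTop Filter.atTop)
    (hWmem : ∀ y ∈ Set.Ici (0:ℝ), W y ∈ Set.Ici (1:ℝ))
    (hVW : ∀ y ∈ Set.Ici (0:ℝ), V (W y) = y)
    (hWV : ∀ x ∈ Set.Ici (1:ℝ), W (V x) = x)
    (Ψ : ℝ → ℝ)
    (hΨ : ∀ x ∈ Set.Ici (1:ℝ), Ψ x = x ^ α / l x)
    (hΨmono : MonotoneOn Ψ (Set.Ici 1))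
    (hΨtop : Filter.Tendsto Ψ Filter.atTop Filter.atTop)
    (q : ℝ → ℝ → ℝ)
    (hq : ∀ t ∈ Set.Ici (0:ℝ), ∀ s ∈ Set.Ico (0:ℝ) 1,
      q t s = 1 / Ψ (W (μ * t + V (1 / (1 - s)))))
    (lam : ℝ) (hlam : 0 < lam) (c : ℝ) (hc : 0 < c) :
    Filter.Tendsto (fun t => q (c * t) (Real.exp (-(lam / W (μ * t)))) / q t 0)
      Filter.atTop (nhds ((c + lam ^ (-γ)) ^ (-(α / γ)))) := by
  obtain ⟨hγ0, -⟩ := hγ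
  have hfpos : ∀ x ∈ Set.Ici (1 : ℝ), 0 < x ^ (γ - 1) / L x := fun x hx =>
    div_pos (Real.rpow_pos_of_pos (one_pos.trans_le hx) _) (hLpos x hx)
  have hfcont : ContinuousOn (fun x => x ^ (γ - 1) / L x) (Set.Ici 1) :=
    (continuousOn_id.rpow_const fun x hx => .inl (one_pos.trans_le hx).ne').div hLcont
      fun x hx => (hLpos x hx).ne'
  have hVmono : MonotoneOn V (Set.Ici 1) := by
    intro a ha b hb hab
    rw [hV a ha, hV b hb]
    have hint : ∀ c ∈ Set.Ici (1 : ℝ),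
        IntervalIntegrable (fun x => x ^ (γ - 1) / L x) volume 1 c := fun c hc =>
      (hfcont.mono fun x hx => (le_min le_rfl hc).trans hx.1).intervalIntegrable
    rw [← sub_nonneg, intervalIntegral.integral_interval_sub_left (hint b hb) (hint a ha)]
    exact intervalIntegral.integral_nonneg hab fun u hu => (hfpos u (le_trans ha hu.1)).le
  have hVone : V 1 = 0 := by rw [hV 1 Set.self_mem_Ici, intervalIntegral.integral_same]
  have hVrv : ∀ k > (0 : ℝ), Tendsto (fun x => V (k * x) / V x) atTop (nhds (k ^ γ)) := by
    intro k hk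
    have h : Tendsto (fun x => ((k * x) ^ (γ - 1) / L (k * x)) / (x ^ (γ - 1) / L x)) atTop
        (nhds (k ^ (γ - 1))) := by
      have h1 := ((hLsv k hk).inv₀ one_ne_zero).const_mul (k ^ (γ - 1))
      rw [inv_one, mul_one] at h1
      refine h1.congr' ?_
      filter_upwards [eventually_gt_atTop 0] with x hx
      have := (Real.rpow_pos_of_pos hx (γ - 1)).ne'
      rw [Real.mul_rpow hk.le hx.le, inv_div]
      field_simp
    have := tendsto_primitive_comp_mul_div hk hfcont hfpos hV hVtop h
    rwa [Real.rpow_sub_one hk.ne', mul_div_cancel₀ _ hk.ne'] at this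
  have hΨrv : ∀ k > (0 : ℝ), Tendsto (fun x => Ψ (k * x) / Ψ x) atTop (nhds (k ^ α)) := by
    intro k hk
    have h1 := ((hlsv k hk).inv₀ one_ne_zero).const_mul (k ^ α)
    rw [inv_one, mul_one] at h1
    refine h1.congr' ?_
    filter_upwards [eventually_ge_atTop 1,
      (tendsto_id.const_mul_atTop hk).eventually_ge_atTop 1] with x hx hkx
    have hx0 : 0 < x := one_pos.trans_le hx
    have := (Real.rpow_pos_of_pos hx0 α).ne'
    rw [id] at hkx
    rw [hΨ _ hkx, hΨ _ hx, Real.mul_rpow hk.le hx0.le, inv_div]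
    field_simp
  have hμt : Tendsto (fun t => μ * t) atTop atTop := tendsto_id.const_mul_atTop hμ
  have hWtop : Tendsto W atTop atTop := by
    refine tendsto_atTop.2 fun B => ?_
    filter_upwards [eventually_gt_atTop (V (max 1 B)), eventually_ge_atTop 0] with y hy hy0
    by_contra! h
    have := hVmono (hWmem y hy0) (le_max_left 1 B) (h.le.trans (le_max_right 1 B))
    rw [hVW y hy0] at this
    linarith
  have hw : Tendsto (fun t => W (μ * t)) atTop atTop := hWtop.comp hμt
  set A : ℝ → ℝ := fun t => 1 / (1 - Real.exp (-(lam / W (μ * t)))) with hA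
  have hs : ∀ t, 0 ≤ t → Real.exp (-(lam / W (μ * t))) ∈ Set.Ico (0 : ℝ) 1 := fun t ht => by
    have : 0 < W (μ * t) := one_pos.trans_le (hWmem _ (mul_nonneg hμ.le ht))
    exact ⟨(Real.exp_pos _).le, Real.exp_lt_one_iff.2 (neg_neg_of_pos (by positivity))⟩
  have hA1 : ∀ t, 0 ≤ t → 1 ≤ A t := fun t ht => by
    have h := hs t ht
    rw [hA]
    exact one_le_one_div (by linarith [h.2]) (by linarith [h.1])
  have hVA : Tendsto (fun t => V (A t) / V (W (μ * t))) atTop (nhds (lam ^ (-γ))) := by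
    have := hVmono.tendsto_div_of_regularlyVarying (one_div_pos.2 hlam) hVtop hVrv hw
      (tendsto_one_div_one_sub_exp_div hlam hw)
    rwa [one_div, Real.inv_rpow hlam.le, ← Real.rpow_neg hlam.le] at this
  set K := c + lam ^ (-γ) with hKdef
  have hK : 0 < K := add_pos hc (Real.rpow_pos_of_pos hlam _)
  have hk : 0 < K ^ γ⁻¹ := Real.rpow_pos_of_pos hK _
  have harg : ∀ t, 0 ≤ t → 0 ≤ μ * (c * t) + V (A t) := fun t ht => by
    have h1 := hVmono Set.self_mem_Ici (hA1 t ht) (hA1 t ht)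
    rw [hVone] at h1
    have : 0 ≤ μ * (c * t) := by positivity
    linarith
  have hVratio : Tendsto (fun t => V (W (μ * (c * t) + V (A t))) / V (W (μ * t))) atTop
      (nhds ((K ^ γ⁻¹) ^ γ)) := by
    rw [Real.rpow_inv_rpow hK.le hγ0.ne']
    refine (hVA.const_add c).congr' ?_
    filter_upwards [eventually_gt_atTop 0] with t ht
    rw [hVW _ (harg t ht.le), hVW _ (mul_nonneg hμ.le ht.le)]
    field_simp
  have hWratio := hVmono.tendsto_div_of_tendsto_div_regularlyVarying hk hγ0 hVtop hVrv hw
    ((eventually_ge_atTop 0).mono fun t ht => hWmem _ (harg t ht)) hVratio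
  have hΨratio := (hΨmono.tendsto_div_of_regularlyVarying hk hΨtop hΨrv hw hWratio).inv₀
    (Real.rpow_pos_of_pos hk _).ne'
  rw [← Real.rpow_mul hK.le, ← Real.rpow_neg hK.le, inv_mul_eq_div] at hΨratio
  refine hΨratio.congr' ?_
  filter_upwards [eventually_ge_atTop 0] with t ht
  rw [hq _ (mul_nonneg hc.le ht) _ (hs t ht), hq t ht 0 ⟨le_rfl, one_pos⟩, sub_zero, div_one,
    hVone, add_zero, inv_div, one_div, one_div (Ψ _), inv_div_inv]
end

section
/- For every s ∈ [0,1), Δ(s) = ∫₀^∞ (1 − g(F(t;s))) dt equals ∫ₛ¹ (1 − g(u))/(μ(f(u) − u)) du; in particular Q = Δ(0) = ∫₀¹ (1 − g(u))/(μ(f(u) − u)) du (the equalities hold in the extended reals, so one side is finite exactly when the other is). -/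
open Filter in
/-- A function on `[a, ∞)` that increases continuously to its limit `b` maps `(a, ∞)` onto
`(φ a, b)`. -/
theorem image_Ioi_eq_Ioo_of_strictMonoOn_of_tendsto {φ : ℝ → ℝ} {a b : ℝ}
    (hcont : ContinuousOn φ (Set.Ici a)) (hmono : StrictMonoOn φ (Set.Ici a))
    (hlim : Tendsto φ atTop (nhds b)) (hlt : ∀ t ∈ Set.Ioi a, φ t < b) :
    φ '' Set.Ioi a = Set.Ioo (φ a) b := by
  ext u
  constructor
  · rintro ⟨t, ht, rfl⟩
    exact ⟨hmono Set.self_mem_Ici (Set.Ioi_subset_Ici_self ht) ht, hlt t ht⟩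
  · rintro ⟨hu₀, hu₁⟩
    obtain ⟨T, hTu, haT⟩ := ((hlim.eventually_const_lt hu₁).and (eventually_gt_atTop a)).exists
    obtain ⟨t, ht, htu⟩ := intermediate_value_Ioo haT.le
      (hcont.mono Set.Icc_subset_Ici_self) ⟨hu₀, hTu⟩
    exact ⟨t, ht.1, htu⟩

open Filter MeasureTheory in
/-- Change of variables along a solution of the autonomous equation `φ' = v ∘ φ` that increases
to its limit `b`. -/
theorem lintegral_comp_eq_lintegral_div_of_hasDerivAt {φ v h : ℝ → ℝ} {a b : ℝ}
    (hderiv : ∀ t ∈ Set.Ici a, HasDerivAt φ (v (φ t)) t)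
    (hpos : ∀ t ∈ Set.Ici a, 0 < v (φ t))
    (hlim : Tendsto φ atTop (nhds b)) (hlt : ∀ t ∈ Set.Ioi a, φ t < b) :
    ∫⁻ t in Set.Ioi a, ENNReal.ofReal (h (φ t))
      = ∫⁻ u in Set.Ioo (φ a) b, ENNReal.ofReal (h u / v u) := by
  have hcont : ContinuousOn φ (Set.Ici a) :=
    fun t ht => (hderiv t ht).continuousAt.continuousWithinAt
  have hmono : StrictMonoOn φ (Set.Ici a) := by
    refine strictMonoOn_of_deriv_pos (convex_Ici a) hcont fun t ht => ?_
    have ht' := interior_subset ht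
    rw [(hderiv t ht').deriv]
    exact hpos t ht'
  rw [← image_Ioi_eq_Ioo_of_strictMonoOn_of_tendsto hcont hmono hlim hlt,
    lintegral_image_eq_lintegral_deriv_mul_of_monotoneOn measurableSet_Ioi
      (fun t ht => (hderiv t (Set.Ioi_subset_Ici_self ht)).hasDerivWithinAt)
      (hmono.monotoneOn.mono Set.Ioi_subset_Ici_self)]
  refine setLIntegral_congr_fun measurableSet_Ioi fun t ht => ?_
  have hv := hpos t (Set.Ioi_subset_Ici_self ht)
  rw [← ENNReal.ofReal_mul hv.le, mul_div_cancel₀ _ hv.ne']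

open Filter MeasureTheory Real in
theorem stmt2
    (μ : ℝ) (hμ : 0 < μ)
    (f g : ℝ → ℝ)
    (hfcont : ContinuousOn f (Set.Icc 0 1)) (hfone : f 1 = 1)
    (hfgt : ∀ u ∈ Set.Ico (0:ℝ) 1, u < f u)
    (hfmem : ∀ u ∈ Set.Icc (0:ℝ) 1, f u ∈ Set.Icc (0:ℝ) 1)
    (hgcont : ContinuousOn g (Set.Icc 0 1)) (hgmono : MonotoneOn g (Set.Icc 0 1))
    (hgone : g 1 = 1) (hgmem : ∀ u ∈ Set.Icc (0:ℝ) 1, g u ∈ Set.Icc (0:ℝ) 1)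
    (F : ℝ → ℝ → ℝ)
    (hF0 : ∀ s ∈ Set.Ico (0:ℝ) 1, F 0 s = s)
    (hFderiv : ∀ s ∈ Set.Ico (0:ℝ) 1, ∀ t ∈ Set.Ici (0:ℝ),
      HasDerivAt (fun u => F u s) (μ * (f (F t s) - F t s)) t)
    (hFmem : ∀ s ∈ Set.Ico (0:ℝ) 1, ∀ t ∈ Set.Ici (0:ℝ), F t s ∈ Set.Ico s 1)
    (hFlim : ∀ s ∈ Set.Ico (0:ℝ) 1, Filter.Tendsto (fun t => F t s) Filter.atTop (nhds 1)) :
    (∀ s ∈ Set.Ico (0:ℝ) 1,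
      (∫⁻ t in Set.Ioi (0:ℝ), ENNReal.ofReal (1 - g (F t s)))
        = ∫⁻ u in Set.Ioo s 1, ENNReal.ofReal ((1 - g u) / (μ * (f u - u))))
    ∧ ((∫⁻ t in Set.Ioi (0:ℝ), ENNReal.ofReal (1 - g (F t 0)))
        = ∫⁻ u in Set.Ioo (0:ℝ) 1, ENNReal.ofReal ((1 - g u) / (μ * (f u - u)))) := by
  have key : ∀ s ∈ Set.Ico (0:ℝ) 1,
      (∫⁻ t in Set.Ioi (0:ℝ), ENNReal.ofReal (1 - g (F t s)))
        = ∫⁻ u in Set.Ioo s 1, ENNReal.ofReal ((1 - g u) / (μ * (f u - u))) := by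
    intro s hs
    have h := lintegral_comp_eq_lintegral_div_of_hasDerivAt (φ := fun t => F t s)
      (v := fun u => μ * (f u - u)) (h := fun u => 1 - g u) (hFderiv s hs)
      (fun t ht => mul_pos hμ (sub_pos.2 (hfgt _ ⟨hs.1.trans (hFmem s hs t ht).1,
        (hFmem s hs t ht).2⟩)))
      (hFlim s hs) (fun t ht => (hFmem s hs t (Set.Ioi_subset_Ici_self ht)).2)
    simpa only [hF0 s hs] using h
  exact ⟨key, key 0 ⟨le_rfl, one_pos⟩⟩
end

section
/- If θ ≥ 1 and ρ ≥ 1, then I(t)/(R(t)q(t) + Q(t)r(t)) → 1 as t → ∞; moreover I(t) → 0 and consequently P_t/(R(t)q(t) + Q(t)r(t)) → 1, i.e. the probability of non-visiting the zero state satisfies P{Y(t) > 0} ∼ R(t)q(t) + Q(t)r(t) as t → ∞. -/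
/-- A positive non-increasing function on `(0, ∞)`, integrable at `0`, that is regularly varying
at infinity with index `-ρ`. -/
structure AntitoneRegVar (f : ℝ → ℝ) (ρ : ℝ) : Prop where
  pos : ∀ t > (0 : ℝ), 0 < f t
  anti : AntitoneOn f (Set.Ioi 0)
  integrableOn : ∀ t > (0 : ℝ), MeasureTheory.IntegrableOn f (Set.Ioc 0 t)
  tendsto : ∀ c > (0 : ℝ),
    Filter.Tendsto (fun t => f (c * t) / f t) Filter.atTop (nhds (c ^ (-ρ)))

namespace AntitoneRegVar

open Filter MeasureTheory Topology Set

variable {f g : ℝ → ℝ} {ρ θ : ℝ}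

lemma intervalIntegrable (hf : AntitoneRegVar f ρ) {a b : ℝ} (ha : 0 ≤ a) (hb : 0 ≤ b) :
    IntervalIntegrable f volume a b := by
  have key : ∀ t : ℝ, 0 ≤ t → IntervalIntegrable f volume 0 t := by
    intro t ht
    rcases ht.eq_or_lt with rfl | ht
    · simp
    · exact (intervalIntegrable_iff_integrableOn_Ioc_of_le ht.le).2 (hf.integrableOn t ht)
  exact (key a ha).symm.trans (key b hb)

lemma mul_le_integral (hf : AntitoneRegVar f ρ) {a b : ℝ} (ha : 0 ≤ a) (hab : a ≤ b) :
    (b - a) * f b ≤ ∫ u in a..b, f u := by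
  have h := intervalIntegral.integral_mono_on_of_le_Ioo (f := fun _ => f b) (g := f) hab
    (by simp) (hf.intervalIntegrable ha (ha.trans hab)) (fun x hx =>
      hf.anti (mem_Ioi.2 (ha.trans_lt hx.1)) (mem_Ioi.2 (ha.trans_lt (hx.1.trans hx.2))) hx.2.le)
  simpa using h

lemma integral_le_mul (hf : AntitoneRegVar f ρ) {a b : ℝ} (ha : 0 < a) (hab : a ≤ b) :
    ∫ u in a..b, f u ≤ (b - a) * f a := by
  have h := intervalIntegral.integral_mono_on_of_le_Ioo (f := f) (g := fun _ => f a) hab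
    (hf.intervalIntegrable ha.le (ha.le.trans hab)) (by simp) (fun x hx =>
      hf.anti (mem_Ioi.2 ha) (mem_Ioi.2 (ha.trans hx.1)) hx.1.le)
  simpa using h

lemma integral_pos (hf : AntitoneRegVar f ρ) {t : ℝ} (ht : 0 < t) : 0 < ∫ u in (0 : ℝ)..t, f u := by
  have h := hf.mul_le_integral le_rfl ht.le
  have := mul_pos ht (hf.pos t ht)
  linarith

lemma integral_add (hf : AntitoneRegVar f ρ) {a b : ℝ} (ha : 0 ≤ a) (hb : 0 ≤ b) :
    (∫ u in (0 : ℝ)..a, f u) + ∫ u in a..b, f u = ∫ u in (0 : ℝ)..b, f u :=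
  intervalIntegral.integral_add_adjacent_intervals (hf.intervalIntegrable le_rfl ha)
    (hf.intervalIntegrable ha hb)

lemma integral_mono (hf : AntitoneRegVar f ρ) {a b : ℝ} (ha : 0 ≤ a) (hab : a ≤ b) :
    ∫ u in (0 : ℝ)..a, f u ≤ ∫ u in (0 : ℝ)..b, f u := by
  rcases hab.eq_or_lt with rfl | h
  · rfl
  have hb := ha.trans_lt h
  have h1 := hf.integral_add ha hb.le
  have h2 := hf.mul_le_integral ha hab
  have := mul_pos (sub_pos.2 h) (hf.pos b hb)
  linarith

lemma two_le_half_rpow_neg (hρ : 1 ≤ ρ) : (2 : ℝ) ≤ (1 / 2 : ℝ) ^ (-ρ) := by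
  have h := Real.rpow_le_rpow_of_exponent_ge (x := 1 / 2) (by norm_num) (by norm_num)
    (neg_le_neg hρ)
  rw [Real.rpow_neg_one] at h
  norm_num at h ⊢
  exact h

lemma eventually_mul_le_integral (hf : AntitoneRegVar f ρ) (hρ : 1 ≤ ρ) (n : ℕ) :
    ∀ᶠ t in atTop, (n / 4 : ℝ) * (t * f t) ≤ ∫ u in (0 : ℝ)..t, f u := by
  induction n with
  | zero =>
    filter_upwards [eventually_gt_atTop 0] with t ht
    simpa using (hf.integral_pos ht).le
  | succ n ih =>
    have hc : 2 * (1 - 1 / (n + 1 : ℝ)) < (1 / 2 : ℝ) ^ (-ρ) := by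
      have := two_le_half_rpow_neg hρ
      have : 0 < 1 / (n + 1 : ℝ) := by positivity
      linarith
    have h1 := (hf.tendsto (1 / 2) (by norm_num)).eventually (lt_mem_nhds hc)
    have h2 := (tendsto_id.const_mul_atTop (show (0 : ℝ) < 1 / 2 by norm_num)).eventually ih
    filter_upwards [h1, h2, eventually_gt_atTop 0] with t h1 h2 ht
    have hft := hf.pos t ht
    rw [lt_div_iff₀ hft] at h1
    simp only [id] at h2
    have h3 := hf.mul_le_integral (a := 1 / 2 * t) (b := t) (by linarith) (by linarith)
    rw [← hf.integral_add (a := 1 / 2 * t) (b := t) (by linarith) ht.le]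
    have h4 : (n / 4 : ℝ) * (1 / 2 * t * (2 * (1 - 1 / (n + 1)) * f t))
        ≤ (n / 4 : ℝ) * (1 / 2 * t * f (1 / 2 * t)) := by gcongr
    have h5 : (n : ℝ) * (1 / (n + 1)) ≤ 1 := by
      rw [mul_one_div, div_le_one (by positivity)]; linarith
    have h6 : (n : ℝ) * (1 / (n + 1)) * (t * f t) ≤ 1 * (t * f t) := by gcongr
    push_cast
    nlinarith

/-- One half of Karamata's theorem, including the boundary case `ρ = 1`. -/
lemma tendsto_mul_div_integral (hf : AntitoneRegVar f ρ) (hρ : 1 ≤ ρ) :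
    Tendsto (fun t => t * f t / ∫ u in (0 : ℝ)..t, f u) atTop (𝓝 0) := by
  refine tendsto_order.2 ⟨fun a ha => ?_, fun a ha => ?_⟩
  · filter_upwards [eventually_gt_atTop 0] with t ht
    exact ha.trans (div_pos (mul_pos ht (hf.pos t ht)) (hf.integral_pos ht))
  · obtain ⟨n, hn⟩ := exists_nat_gt (4 / a)
    filter_upwards [hf.eventually_mul_le_integral hρ n, eventually_gt_atTop 0] with t h ht
    have hp := mul_pos ht (hf.pos t ht)
    rw [div_lt_iff₀ (hf.integral_pos ht)]
    rw [div_lt_iff₀ ha] at hn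
    nlinarith

lemma tendsto_integral_mul_div_integral (hf : AntitoneRegVar f ρ) (hρ : 1 ≤ ρ) {c : ℝ}
    (hc : 0 < c) (hc1 : c ≤ 1) :
    Tendsto (fun t => (∫ u in (0 : ℝ)..(c * t), f u) / ∫ u in (0 : ℝ)..t, f u) atTop (𝓝 1) := by
  have h0 : Tendsto (fun t => 1 - (f (c * t) / f t) * (t * f t / ∫ u in (0 : ℝ)..t, f u)) atTop
      (𝓝 1) := by
    simpa using ((hf.tendsto c hc).mul (hf.tendsto_mul_div_integral hρ)).const_sub 1
  refine tendsto_of_tendsto_of_tendsto_of_le_of_le' h0 tendsto_const_nhds ?_ ?_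
  · filter_upwards [eventually_gt_atTop 0] with t ht
    have hct := mul_pos hc ht
    have hle : c * t ≤ t := by nlinarith
    have hF := hf.integral_pos ht
    have hft := hf.pos t ht
    have h1 := hf.integral_add hct.le ht.le
    have h2 := hf.integral_le_mul hct hle
    have h3 := mul_pos hct (hf.pos _ hct)
    rw [le_div_iff₀ hF]
    have h4 : f (c * t) / f t * (t * f t / ∫ u in (0 : ℝ)..t, f u) * (∫ u in (0 : ℝ)..t, f u)
        = t * f (c * t) := by field_simp
    rw [sub_mul, h4]
    linarith
  · filter_upwards [eventually_gt_atTop 0] with t ht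
    exact (div_le_one (hf.integral_pos ht)).2
      (hf.integral_mono (mul_pos hc ht).le (by nlinarith))

lemma intervalIntegrable_conv (hg : AntitoneRegVar g θ) (hf : AntitoneRegVar f ρ) {t a b : ℝ}
    (ha : 0 ≤ a) (hab : a ≤ b) (hbt : b < t) :
    IntervalIntegrable (fun u => g (t - u) * f u) volume a b := by
  have hfi := (intervalIntegrable_iff_integrableOn_Ioc_of_le hab).1
    (hf.intervalIntegrable ha (ha.trans hab))
  refine (intervalIntegrable_iff_integrableOn_Ioc_of_le hab).2
    (Integrable.bdd_mul (c := g (t - b)) hfi ?_ ?_)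
  · refine (aemeasurable_restrict_of_monotoneOn measurableSet_Ioc ?_).aestronglyMeasurable
    intro x hx y hy hxy
    exact hg.anti (mem_Ioi.2 (by linarith [hy.2])) (mem_Ioi.2 (by linarith [hx.2])) (by linarith)
  · filter_upwards [ae_restrict_mem measurableSet_Ioc] with x hx
    have hpos : 0 < t - x := by linarith [hx.2]
    rw [Real.norm_of_nonneg (hg.pos _ hpos).le]
    exact hg.anti (mem_Ioi.2 (by linarith)) (mem_Ioi.2 hpos) (by linarith [hx.2])

lemma mul_integral_le_conv (hg : AntitoneRegVar g θ) (hf : AntitoneRegVar f ρ) {t : ℝ}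
    (ht : 0 < t) :
    g t * ∫ u in (0 : ℝ)..(1 / 2 * t), f u ≤ ∫ u in (0 : ℝ)..(1 / 2 * t), g (t - u) * f u := by
  rw [← intervalIntegral.integral_const_mul]
  refine intervalIntegral.integral_mono_on_of_le_Ioo (by linarith)
    ((hf.intervalIntegrable le_rfl (by linarith)).const_mul _)
    (hg.intervalIntegrable_conv hf le_rfl (by linarith) (by linarith)) fun x hx => ?_
  exact mul_le_mul_of_nonneg_right
    (hg.anti (mem_Ioi.2 (by linarith [hx.2])) (mem_Ioi.2 ht) (by linarith [hx.1]))
    (hf.pos x hx.1).le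

lemma conv_le (hg : AntitoneRegVar g θ) (hf : AntitoneRegVar f ρ) {t c : ℝ} (ht : 0 < t)
    (hc : 0 < c) (hc2 : c < 1 / 2) :
    ∫ u in (0 : ℝ)..(1 / 2 * t), g (t - u) * f u ≤
      g ((1 - c) * t) * (∫ u in (0 : ℝ)..t, f u) + t * (g (1 / 2 * t) * f (c * t)) := by
  have hct := mul_pos hc ht
  have hct2 : c * t < 1 / 2 * t := by nlinarith
  have hgc : 0 < g ((1 - c) * t) := hg.pos _ (by nlinarith)
  have hgh : 0 < g (1 / 2 * t) := hg.pos _ (by linarith)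
  have hfc : 0 < f (c * t) := hf.pos _ hct
  have i1 := hg.intervalIntegrable_conv hf (t := t) le_rfl hct.le (by linarith)
  have i2 := hg.intervalIntegrable_conv hf (t := t) hct.le hct2.le (by linarith)
  rw [← intervalIntegral.integral_add_adjacent_intervals i1 i2]
  refine add_le_add ?_ ?_
  · calc ∫ u in (0 : ℝ)..(c * t), g (t - u) * f u
        ≤ ∫ u in (0 : ℝ)..(c * t), g ((1 - c) * t) * f u := by
          refine intervalIntegral.integral_mono_on_of_le_Ioo hct.le i1
            ((hf.intervalIntegrable le_rfl hct.le).const_mul _) fun x hx => ?_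
          exact mul_le_mul_of_nonneg_right
            (hg.anti (mem_Ioi.2 (by nlinarith)) (mem_Ioi.2 (by linarith [hx.2]))
              (by linarith [hx.2])) (hf.pos x hx.1).le
      _ = g ((1 - c) * t) * ∫ u in (0 : ℝ)..(c * t), f u := by
          rw [intervalIntegral.integral_const_mul]
      _ ≤ _ := mul_le_mul_of_nonneg_left (hf.integral_mono hct.le (by linarith)) hgc.le
  · calc ∫ u in (c * t)..(1 / 2 * t), g (t - u) * f u
        ≤ ∫ u in (c * t)..(1 / 2 * t), g (1 / 2 * t) * f (c * t) := by
          refine intervalIntegral.integral_mono_on_of_le_Ioo hct2.le i2 (by simp) fun x hx => ?_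
          exact mul_le_mul
            (hg.anti (mem_Ioi.2 (by linarith)) (mem_Ioi.2 (by linarith [hx.2]))
              (by linarith [hx.2]))
            (hf.anti (mem_Ioi.2 hct) (mem_Ioi.2 (hct.trans hx.1)) hx.1.le)
            (hf.pos x (hct.trans hx.1)).le hgh.le
      _ = (1 / 2 * t - c * t) * (g (1 / 2 * t) * f (c * t)) := by
          rw [intervalIntegral.integral_const, smul_eq_mul]
      _ ≤ _ := mul_le_mul_of_nonneg_right (by linarith) (mul_pos hgh hfc).le

/-- The part of the convolution away from the singularity of `g` is asymptotic to
`g t * ∫ u in 0..t, f u`. -/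
lemma tendsto_conv_div (hg : AntitoneRegVar g θ) (hf : AntitoneRegVar f ρ) (hρ : 1 ≤ ρ) :
    Tendsto (fun t => (∫ u in (0 : ℝ)..(1 / 2 * t), g (t - u) * f u) /
      (g t * ∫ u in (0 : ℝ)..t, f u)) atTop (𝓝 1) := by
  refine tendsto_order.2 ⟨fun a ha => ?_, fun a ha => ?_⟩
  · have h := (hf.tendsto_integral_mul_div_integral hρ (c := 1 / 2) (by norm_num)
      (by norm_num)).eventually (lt_mem_nhds ha)
    filter_upwards [h, eventually_gt_atTop 0] with t h ht
    refine h.trans_le ?_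
    have hF := hf.integral_pos ht
    have hgt := hg.pos t ht
    rw [div_le_div_iff₀ hF (mul_pos hgt hF)]
    nlinarith [hg.mul_integral_le_conv hf ht]
  · have hlim : Tendsto (fun c : ℝ => (1 - c) ^ (-θ)) (𝓝[>] 0) (𝓝 1) := by
      have hcont : ContinuousAt (fun c : ℝ => (1 - c) ^ (-θ)) 0 :=
        ContinuousAt.rpow_const (by fun_prop) (by norm_num)
      have := hcont.tendsto
      simp only [sub_zero, Real.one_rpow] at this
      exact this.mono_left nhdsWithin_le_nhds
    obtain ⟨c, hca, hc, hc2⟩ := ((hlim.eventually (gt_mem_nhds ha)).and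
      (Ioo_mem_nhdsGT (show (0 : ℝ) < 1 / 2 by norm_num))).exists
    have h0 : Tendsto (fun t => g ((1 - c) * t) / g t + (g (1 / 2 * t) / g t) * (f (c * t) / f t) *
        (t * f t / ∫ u in (0 : ℝ)..t, f u)) atTop (𝓝 ((1 - c) ^ (-θ))) := by
      simpa using (hg.tendsto (1 - c) (by linarith)).add
        (((hg.tendsto (1 / 2) (by norm_num)).mul (hf.tendsto c hc)).mul
          (hf.tendsto_mul_div_integral hρ))
    filter_upwards [h0.eventually (gt_mem_nhds hca), eventually_gt_atTop 0] with t h ht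
    refine lt_of_le_of_lt ?_ h
    have hF := hf.integral_pos ht
    have hgt := hg.pos t ht
    have hft := hf.pos t ht
    rw [div_le_iff₀ (mul_pos hgt hF)]
    refine (hg.conv_le hf ht hc hc2).trans (le_of_eq ?_)
    field_simp

lemma tendsto_integral_mul (hg : AntitoneRegVar g θ) (hf : AntitoneRegVar f ρ) (hθ : 1 ≤ θ)
    (hρ : 1 ≤ ρ) :
    Tendsto (fun t => (∫ u in (0 : ℝ)..t, g u) * f t) atTop (𝓝 0) := by
  set G : ℝ → ℝ := fun t => ∫ u in (0 : ℝ)..t, g u with hG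
  have hlim : Tendsto (fun t => (G (1 / 2 * t) / G t) * (f (1 / 2 * (1 / 2 * t)) / f (1 / 2 * t)))
      atTop (𝓝 (1 * (1 / 2) ^ (-ρ))) :=
    (hg.tendsto_integral_mul_div_integral hθ (by norm_num) (by norm_num)).mul
      ((hf.tendsto (1 / 2) (by norm_num)).comp
        (tendsto_id.const_mul_atTop (show (0 : ℝ) < 1 / 2 by norm_num)))
  have hbig : (4 / 3 : ℝ) < 1 * (1 / 2) ^ (-ρ) := by linarith [two_le_half_rpow_neg hρ]
  obtain ⟨T₀, hT₀⟩ := eventually_atTop.1 (hlim.eventually (lt_mem_nhds hbig))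
  set T := max T₀ 1
  have hT : 0 < T := lt_of_lt_of_le one_pos (le_max_right _ _)
  set a : ℕ → ℝ := fun n => G (2 ^ (n + 1) * T) * f (2 ^ n * T) with ha
  have hstep : ∀ n, a (n + 1) ≤ 3 / 4 * a n := by
    intro n
    have hle : T ≤ 2 ^ n * T := le_mul_of_one_le_left hT.le (one_le_pow₀ (by norm_num))
    have hn : 0 < 2 ^ n * T := hT.trans_le hle
    have h := hT₀ (2 ^ (n + 2) * T) (by
      have : 2 ^ (n + 2) * T = 4 * (2 ^ n * T) := by ring
      have := le_max_left T₀ 1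
      linarith)
    have e1 : 1 / 2 * (2 ^ (n + 2) * T) = 2 ^ (n + 1) * T := by ring
    have e2 : 1 / 2 * (2 ^ (n + 1) * T) = 2 ^ n * T := by ring
    rw [e1, e2, div_mul_div_comm, lt_div_iff₀ (mul_pos (hg.integral_pos (by positivity))
      (hf.pos _ (by positivity)))] at h
    simp only [ha]
    rw [show n + 1 + 1 = n + 2 from rfl]
    linarith
  have hapos : ∀ n, 0 ≤ a n := fun n =>
    (mul_pos (hg.integral_pos (by positivity)) (hf.pos _ (by positivity))).le
  have hbound : ∀ n, a n ≤ (3 / 4) ^ n * a 0 := by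
    intro n
    induction n with
    | zero => simp
    | succ n ih => rw [pow_succ]; linarith [hstep n]
  have hazero : Tendsto a atTop (𝓝 0) := by
    refine squeeze_zero hapos hbound ?_
    simpa using (tendsto_pow_atTop_nhds_zero_of_lt_one (r := (3 / 4 : ℝ)) (by norm_num)
      (by norm_num)).mul_const (a 0)
  refine tendsto_order.2 ⟨fun b hb => ?_, fun b hb => ?_⟩
  · filter_upwards [eventually_gt_atTop 0] with t ht
    exact hb.trans (mul_pos (hg.integral_pos ht) (hf.pos t ht))
  · obtain ⟨N, hN⟩ := eventually_atTop.1 (hazero.eventually (gt_mem_nhds hb))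
    filter_upwards [eventually_ge_atTop (2 ^ N * T)] with t ht
    have ht' : 2 ^ N ≤ t / T := (le_div_iff₀ hT).2 ht
    obtain ⟨n, hn, hn'⟩ := exists_nat_pow_near ((one_le_pow₀ (by norm_num)).trans ht')
      (show (1 : ℝ) < 2 by norm_num)
    have hNn : N ≤ n := Nat.lt_succ_iff.1
      ((pow_lt_pow_iff_right₀ (show (1 : ℝ) < 2 by norm_num)).1 (ht'.trans_lt hn'))
    rw [le_div_iff₀ hT] at hn
    rw [div_lt_iff₀ hT] at hn'
    have hnT : 0 < 2 ^ n * T := by positivity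
    refine lt_of_le_of_lt ?_ (hN n hNn)
    exact mul_le_mul (hg.integral_mono (hnT.trans_le hn).le hn'.le)
      (hf.anti (mem_Ioi.2 hnT) (mem_Ioi.2 (hnT.trans_le hn)) hn)
      (hf.pos _ (hnT.trans_le hn)).le (hg.integral_pos (by positivity)).le

lemma conv_eq_add (hg : AntitoneRegVar g θ) (hf : AntitoneRegVar f ρ) {t : ℝ} (ht : 0 < t) :
    ∫ u in (0 : ℝ)..t, g (t - u) * f u =
      (∫ u in (0 : ℝ)..(1 / 2 * t), g (t - u) * f u) +
        ∫ u in (0 : ℝ)..(1 / 2 * t), f (t - u) * g u := by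
  have i1 := hg.intervalIntegrable_conv hf (t := t) (b := 1 / 2 * t) le_rfl (by linarith)
    (by linarith)
  have i2 := (hf.intervalIntegrable_conv hg (t := t) (b := 1 / 2 * t) le_rfl (by linarith)
    (by linarith)).comp_sub_left t
  have e1 : t - 1 / 2 * t = 1 / 2 * t := by ring
  have e2 := intervalIntegral.integral_comp_sub_left (a := 1 / 2 * t) (b := t)
    (fun u => f (t - u) * g u) t
  simp only [sub_sub_cancel, sub_self, sub_zero, e1] at i2 e2
  simp only [mul_comm (f _)] at i2 e2 ⊢
  rw [← e2, intervalIntegral.integral_add_adjacent_intervals i1 i2.symm]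

end AntitoneRegVar

lemma tendsto_add_div_add_one {ι : Type*} {l : Filter ι} {A B a b : ι → ℝ}
    (ha : ∀ᶠ i in l, 0 < a i) (hb : ∀ᶠ i in l, 0 < b i)
    (hA : Filter.Tendsto (fun i => A i / a i) l (nhds 1))
    (hB : Filter.Tendsto (fun i => B i / b i) l (nhds 1)) :
    Filter.Tendsto (fun i => (A i + B i) / (a i + b i)) l (nhds 1) := by
  refine tendsto_order.2 ⟨fun c hc => ?_, fun c hc => ?_⟩
  · filter_upwards [ha, hb, hA.eventually (lt_mem_nhds hc), hB.eventually (lt_mem_nhds hc)]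
      with i ha hb hA hB
    rw [lt_div_iff₀ ha] at hA
    rw [lt_div_iff₀ hb] at hB
    rw [lt_div_iff₀ (add_pos ha hb)]
    linarith
  · filter_upwards [ha, hb, hA.eventually (gt_mem_nhds hc), hB.eventually (gt_mem_nhds hc)]
      with i ha hb hA hB
    rw [div_lt_iff₀ ha] at hA
    rw [div_lt_iff₀ hb] at hB
    rw [div_lt_iff₀ (add_pos ha hb)]
    linarith

lemma tendsto_one_sub_exp_neg_div :
    Filter.Tendsto (fun x : ℝ => (1 - Real.exp (-x)) / x) (nhdsWithin 0 {0}ᶜ) (nhds 1) := by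
  have h : HasDerivAt (fun x : ℝ => 1 - Real.exp (-x)) 1 0 := by
    simpa using ((hasDerivAt_neg (0 : ℝ)).exp).const_sub 1
  refine (hasDerivAt_iff_tendsto_slope.1 h).congr fun x => ?_
  simp [slope_def_field]


open Filter MeasureTheory Real in
theorem stmt3
    (θ ρ : ℝ) (hθpos : 0 < θ) (hρpos : 0 < ρ)
    (r q : ℝ → ℝ)
    (hrpos : ∀ t > (0:ℝ), 0 < r t) (hqpos : ∀ t > (0:ℝ), 0 < q t)
    (hranti : AntitoneOn r (Set.Ioi 0)) (hqanti : AntitoneOn q (Set.Ioi 0))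
    (hrint : ∀ t > (0:ℝ), MeasureTheory.IntegrableOn r (Set.Ioc 0 t))
    (hqint : ∀ t > (0:ℝ), MeasureTheory.IntegrableOn q (Set.Ioc 0 t))
    (hrrv : ∀ c > (0:ℝ), Filter.Tendsto (fun t => r (c * t) / r t) Filter.atTop (nhds (c ^ (-θ))))
    (hqrv : ∀ c > (0:ℝ), Filter.Tendsto (fun t => q (c * t) / q t) Filter.atTop (nhds (c ^ (-ρ))))
    (R Q I P : ℝ → ℝ)
    (hR : ∀ t, R t = ∫ u in (0:ℝ)..t, r u)
    (hQ : ∀ t, Q t = ∫ u in (0:ℝ)..t, q u)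
    (hI : ∀ t, I t = ∫ u in (0:ℝ)..t, r (t - u) * q u)
    (hP : ∀ t, P t = 1 - Real.exp (-(I t)))
    (hθ : 1 ≤ θ) (hρ : 1 ≤ ρ) :
    Filter.Tendsto (fun t => I t / (R t * q t + Q t * r t)) Filter.atTop (nhds 1)
    ∧ Filter.Tendsto I Filter.atTop (nhds 0)
    ∧ Filter.Tendsto (fun t => P t / (R t * q t + Q t * r t)) Filter.atTop (nhds 1) := by
  have hr : AntitoneRegVar r θ := ⟨hrpos, hranti, hrint, hrrv⟩
  have hq : AntitoneRegVar q ρ := ⟨hqpos, hqanti, hqint, hqrv⟩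
  obtain rfl : R = fun t => ∫ u in (0:ℝ)..t, r u := funext hR
  obtain rfl : Q = fun t => ∫ u in (0:ℝ)..t, q u := funext hQ
  have hD : ∀ t > (0:ℝ), 0 < (∫ u in (0:ℝ)..t, r u) * q t + (∫ u in (0:ℝ)..t, q u) * r t :=
    fun t ht => add_pos (mul_pos (hr.integral_pos ht) (hq.pos t ht))
      (mul_pos (hq.integral_pos ht) (hr.pos t ht))
  have h1 : Tendsto
      (fun t => I t / ((∫ u in (0:ℝ)..t, r u) * q t + (∫ u in (0:ℝ)..t, q u) * r t))
      atTop (nhds 1) := by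
    refine (tendsto_add_div_add_one ?_ ?_ (hr.tendsto_conv_div hq hρ)
      (hq.tendsto_conv_div hr hθ)).congr' ?_
    · filter_upwards [eventually_gt_atTop 0] with t ht
      exact mul_pos (hr.pos t ht) (hq.integral_pos ht)
    · filter_upwards [eventually_gt_atTop 0] with t ht
      exact mul_pos (hq.pos t ht) (hr.integral_pos ht)
    · filter_upwards [eventually_gt_atTop 0] with t ht
      rw [hI, hr.conv_eq_add hq ht, mul_comm (r t), mul_comm (q t)]
      congr 1
      exact add_comm _ _
  have h2 : Tendsto I atTop (nhds 0) := by
    have h := h1.mul ((hr.tendsto_integral_mul hq hθ hρ).add (hq.tendsto_integral_mul hr hρ hθ))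
    rw [add_zero, mul_zero] at h
    refine h.congr' ?_
    filter_upwards [eventually_gt_atTop 0] with t ht
    exact div_mul_cancel₀ _ (hD t ht).ne'
  have hI0 : ∀ᶠ t in atTop, I t ≠ 0 := by
    filter_upwards [h1.eventually (lt_mem_nhds one_pos)] with t h h0
    simp [h0] at h
  refine ⟨h1, h2, ?_⟩
  have h3 := (tendsto_one_sub_exp_neg_div.comp
    (tendsto_nhdsWithin_iff.2 ⟨h2, hI0⟩)).mul h1
  rw [one_mul] at h3
  refine h3.congr' ?_
  filter_upwards [hI0] with t h
  simp only [Function.comp_apply, hP]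
  exact div_mul_div_cancel₀ h
end

section
/- If 0 < θ < 1, 0 < ρ < 1, θ + ρ = 1, and t·r(t)·q(t) → K ∈ (0,∞) as t → ∞, then I(t) → K·π/sin(πθ) and consequently P_t → 1 − exp(−Kπ/sin(πθ)) as t → ∞. -/
open Filter MeasureTheory Set Topology in
/-- One half of Karamata's theorem: the primitive of a decreasing regularly varying function `g` of
index greater than `-1` is `O(t * g t)`. -/
theorem eventually_integral_le_mul_of_regularlyVarying {g : ℝ → ℝ} {ρ : ℝ} (hρ : ρ < 1)
    (hpos : ∀ t > (0 : ℝ), 0 < g t) (hanti : AntitoneOn g (Ioi 0))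
    (hint : ∀ t > (0 : ℝ), IntegrableOn g (Ioc 0 t))
    (hrv : Tendsto (fun t => g (2 * t) / g t) atTop (𝓝 ((2 : ℝ) ^ (-ρ)))) :
    ∃ C > (0 : ℝ), ∀ᶠ t in atTop, ∫ u in (0 : ℝ)..t, g u ≤ C * (t * g t) := by
  have hhalf : (1 / 2 : ℝ) < 2 ^ (-ρ) := by
    calc (1 / 2 : ℝ) = 2 ^ (-1 : ℝ) := by rw [Real.rpow_neg_one]; norm_num
      _ < 2 ^ (-ρ) := Real.rpow_lt_rpow_of_exponent_lt (by norm_num) (by linarith)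
  obtain ⟨l, hl, hl'⟩ := exists_between hhalf
  obtain ⟨T, hT⟩ := eventually_atTop.1 ((hrv.eventually_const_lt hl').and (eventually_gt_atTop 0))
  have hT0 : 0 < T := (hT T le_rfl).2
  have hii : ∀ a b : ℝ, 0 ≤ a → a ≤ b → IntervalIntegrable g volume a b := fun a b ha hab => by
    rw [intervalIntegrable_iff_integrableOn_Ioc_of_le hab]
    rcases hab.eq_or_lt with rfl | hlt
    · simp
    · exact (hint b (ha.trans_lt hlt)).mono_set (Ioc_subset_Ioc_left ha)
  have hnn : ∀ a b : ℝ, 0 ≤ a → a ≤ b → 0 ≤ ∫ u in a..b, g u := fun a b ha hab => by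
    rw [intervalIntegral.integral_of_le hab]
    exact setIntegral_nonneg measurableSet_Ioc fun x hx => (hpos x (ha.trans_lt hx.1)).le
  set C : ℝ := max ((∫ u in (0 : ℝ)..2 * T, g u) / (T * g (2 * T))) (1 / (2 * l - 1)) with hC
  have hC1 : 1 / (2 * l - 1) ≤ C := le_max_right _ _
  have hl1 : 0 < 2 * l - 1 := by linarith
  have hC0 : 0 < C := (one_div_pos.2 hl1).trans_le hC1
  have hC2 : C + 1 ≤ 2 * l * C := by
    rw [div_le_iff₀ hl1] at hC1
    linarith
  have key : ∀ n : ℕ, ∀ t, T ≤ t → t ≤ 2 ^ (n + 1) * T →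
      ∫ u in (0 : ℝ)..t, g u ≤ C * (t * g t) := by
    intro n
    induction n with
    | zero =>
      intro t h1 h2
      have ht0 : 0 < t := hT0.trans_le h1
      have h2' : t ≤ 2 * T := by simpa using h2
      have hg2 := hpos (2 * T) (by linarith)
      have hle : (∫ u in (0 : ℝ)..2 * T, g u) ≤ C * (T * g (2 * T)) := by
        rw [← div_le_iff₀ (by positivity)]
        exact le_max_left _ _
      have hadd := intervalIntegral.integral_add_adjacent_intervals
        (hii 0 t le_rfl ht0.le) (hii t (2 * T) ht0.le h2')
      have hrest := hnn t (2 * T) ht0.le h2'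
      have hg := hanti (mem_Ioi.2 ht0) (mem_Ioi.2 (ht0.trans_le h2')) h2'
      calc ∫ u in (0 : ℝ)..t, g u ≤ C * (T * g (2 * T)) := by linarith
        _ ≤ C * (t * g t) := by gcongr
    | succ n ih =>
      intro t h1 h2
      rcases le_total t (2 ^ (n + 1) * T) with h | h
      · exact ih t h1 h
      obtain ⟨s, rfl⟩ : ∃ s, t = 2 * s := ⟨t / 2, by ring⟩
      have hs1 : T ≤ s := by
        have : (2 : ℝ) ≤ 2 ^ (n + 1) := by
          rw [pow_succ]
          linarith [one_le_pow₀ (n := n) (one_le_two : (1 : ℝ) ≤ 2)]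
        nlinarith
      have hs2 : s ≤ 2 ^ (n + 1) * T := by
        rw [pow_succ] at h2
        linarith
      have hs0 : 0 < s := hT0.trans_le hs1
      have hgs := hpos s hs0
      have hadd := intervalIntegral.integral_add_adjacent_intervals
        (hii 0 s le_rfl hs0.le) (hii s (2 * s) hs0.le (by linarith))
      have htail : ∫ u in s..2 * s, g u ≤ s * g s := by
        have := intervalIntegral.integral_mono_on (by linarith) (hii s (2 * s) hs0.le (by linarith))
          (intervalIntegrable_const (c := g s) (μ := volume)) fun x hx =>
            hanti (mem_Ioi.2 hs0) (mem_Ioi.2 (hs0.trans_le hx.1)) hx.1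
        rw [intervalIntegral.integral_const, smul_eq_mul] at this
        linarith
      have hdouble : l * g s ≤ g (2 * s) := ((lt_div_iff₀ hgs).1 (hT s hs1).1).le
      calc ∫ u in (0 : ℝ)..2 * s, g u ≤ (C + 1) * (s * g s) := by linarith [ih s hs1 hs2]
        _ ≤ 2 * l * C * (s * g s) := by gcongr
        _ = C * (2 * s * (l * g s)) := by ring
        _ ≤ C * (2 * s * g (2 * s)) := by gcongr
  refine ⟨C, hC0, (eventually_ge_atTop T).mono fun t ht => ?_⟩
  obtain ⟨n, hn⟩ := pow_unbounded_of_one_lt (t / T) (one_lt_two (α := ℝ))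
  refine key n t ht ?_
  rw [div_lt_iff₀ hT0] at hn
  rw [pow_succ]
  nlinarith [pow_pos (two_pos (α := ℝ)) n]

open MeasureTheory Set in
/-- The convolution integrand of two decreasing functions is integrable away from the singularity
of the reflected factor. -/
theorem intervalIntegrable_comp_sub_mul_of_antitoneOn {r q : ℝ → ℝ} {a t : ℝ} (ha : 0 ≤ a)
    (hat : a < t) (hrpos : ∀ t > (0 : ℝ), 0 < r t) (hranti : AntitoneOn r (Ioi 0))
    (hqint : ∀ t > (0 : ℝ), IntegrableOn q (Ioc 0 t)) :
    IntervalIntegrable (fun u => r (t - u) * q u) volume 0 a := by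
  rw [intervalIntegrable_iff_integrableOn_Ioc_of_le ha]
  rcases ha.eq_or_lt with rfl | ha
  · simp
  refine (hqint a ha).bdd_mul (c := r (t - a)) ?_ ?_
  · refine (aemeasurable_restrict_of_monotoneOn measurableSet_Ioc ?_).aestronglyMeasurable
    intro x hx y hy hxy
    exact hranti (mem_Ioi.2 (by linarith [hy.2])) (mem_Ioi.2 (by linarith [hx.2])) (by linarith)
  · refine (ae_restrict_iff' measurableSet_Ioc).2 (.of_forall fun x hx => ?_)
    rw [Real.norm_of_nonneg (hrpos _ (by linarith [hx.2])).le]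
    exact hranti (mem_Ioi.2 (by linarith)) (mem_Ioi.2 (by linarith [hx.2])) (by linarith [hx.2])

open Filter MeasureTheory Set Topology in
/-- The part of a convolution near the singularity of the second factor is uniformly small. -/
theorem eventually_convolution_edge_le {r q : ℝ → ℝ} {θ ρ K : ℝ} (hρ : ρ < 1) (hK : 0 < K)
    (hrpos : ∀ t > (0 : ℝ), 0 < r t) (hqpos : ∀ t > (0 : ℝ), 0 < q t)
    (hranti : AntitoneOn r (Ioi 0)) (hqanti : AntitoneOn q (Ioi 0))
    (hqint : ∀ t > (0 : ℝ), IntegrableOn q (Ioc 0 t))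
    (hrrv : ∀ c > (0 : ℝ), Tendsto (fun t => r (c * t) / r t) atTop (𝓝 (c ^ (-θ))))
    (hqrv : ∀ c > (0 : ℝ), Tendsto (fun t => q (c * t) / q t) atTop (𝓝 (c ^ (-ρ))))
    (hlim : Tendsto (fun t => t * r t * q t) atTop (𝓝 K)) :
    ∃ C > (0 : ℝ), ∀ δ > (0 : ℝ), δ ≤ 1 / 2 →
      ∀ᶠ t in atTop, ∫ u in (0 : ℝ)..δ * t, r (t - u) * q u ≤ C * δ ^ (1 - ρ) := by
  obtain ⟨C, hC, hCev⟩ :=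
    eventually_integral_le_mul_of_regularlyVarying hρ hqpos hqanti hqint (hqrv 2 two_pos)
  refine ⟨2 * (C * K * (1 / 2) ^ (-θ)), by positivity, fun δ hδ hδ2 => ?_⟩
  have hlim' : Tendsto (fun t => C * δ * ((t * r t * q t) * (r (1 / 2 * t) / r t) *
      (q (δ * t) / q t))) atTop (𝓝 (C * δ * (K * (1 / 2) ^ (-θ) * δ ^ (-ρ)))) :=
    ((hlim.mul (hrrv _ (by norm_num))).mul (hqrv δ hδ)).const_mul _
  have hval : C * δ * (K * (1 / 2) ^ (-θ) * δ ^ (-ρ)) = C * K * (1 / 2) ^ (-θ) * δ ^ (1 - ρ) := by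
    rw [sub_eq_add_neg, Real.rpow_add hδ, Real.rpow_one]
    ring
  have hposval : 0 < C * K * (1 / 2) ^ (-θ) * δ ^ (1 - ρ) := by positivity
  rw [hval] at hlim'
  have hlt : C * K * (1 / 2) ^ (-θ) * δ ^ (1 - ρ) < 2 * (C * K * (1 / 2) ^ (-θ)) * δ ^ (1 - ρ) := by
    linarith
  filter_upwards [hlim'.eventually_lt_const hlt, (tendsto_id.const_mul_atTop hδ).eventually hCev,
    eventually_gt_atTop 0] with t h1 h2 ht
  have hδt : 0 < δ * t := mul_pos hδ ht
  have hδt2 : δ * t ≤ 1 / 2 * t := by gcongr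
  have hr2 := hrpos (1 / 2 * t) (by linarith)
  have hr := hrpos t ht
  have hq := hqpos t ht
  have hqii : IntervalIntegrable q volume 0 (δ * t) := by
    rw [intervalIntegrable_iff_integrableOn_Ioc_of_le hδt.le]
    exact hqint _ hδt
  calc ∫ u in (0 : ℝ)..δ * t, r (t - u) * q u
      ≤ ∫ u in (0 : ℝ)..δ * t, r (1 / 2 * t) * q u := by
        refine intervalIntegral.integral_mono_on_of_le_Ioo hδt.le
          (intervalIntegrable_comp_sub_mul_of_antitoneOn hδt.le (by linarith) hrpos hranti hqint)
          (hqii.const_mul _) fun x hx => ?_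
        refine mul_le_mul_of_nonneg_right ?_ (hqpos x hx.1).le
        exact hranti (mem_Ioi.2 (by linarith)) (mem_Ioi.2 (by linarith [hx.2])) (by linarith [hx.2])
    _ = r (1 / 2 * t) * ∫ u in (0 : ℝ)..δ * t, q u := intervalIntegral.integral_const_mul _ _
    _ ≤ r (1 / 2 * t) * (C * (δ * t * q (δ * t))) := by gcongr; exact h2
    _ = C * δ * ((t * r t * q t) * (r (1 / 2 * t) / r t) * (q (δ * t) / q t)) := by
        field_simp
    _ ≤ _ := h1.le

open Filter MeasureTheory Set Topology in
/-- The rescaled middle part of a convolution converges. -/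
theorem tendsto_convolution_middle {r q : ℝ → ℝ} {θ ρ K δ : ℝ} (hδ : 0 < δ) (hδ2 : δ ≤ 1 / 2)
    (hrpos : ∀ t > (0 : ℝ), 0 < r t) (hqpos : ∀ t > (0 : ℝ), 0 < q t)
    (hranti : AntitoneOn r (Ioi 0)) (hqanti : AntitoneOn q (Ioi 0))
    (hrrv : ∀ c > (0 : ℝ), Tendsto (fun t => r (c * t) / r t) atTop (𝓝 (c ^ (-θ))))
    (hqrv : ∀ c > (0 : ℝ), Tendsto (fun t => q (c * t) / q t) atTop (𝓝 (c ^ (-ρ))))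
    (hlim : Tendsto (fun t => t * r t * q t) atTop (𝓝 K)) :
    Tendsto (fun t => ∫ u in δ * t..(1 - δ) * t, r (t - u) * q u) atTop
      (𝓝 (∫ x in δ..1 - δ, K * (1 - x) ^ (-θ) * x ^ (-ρ))) := by
  have hratio : ∀ a > (0 : ℝ), ∀ b > (0 : ℝ),
      Tendsto (fun t => t * (r (a * t) * q (b * t))) atTop (𝓝 (K * a ^ (-θ) * b ^ (-ρ))) := by
    intro a ha b hb
    refine ((hlim.mul (hrrv a ha)).mul (hqrv b hb)).congr' ?_
    filter_upwards [eventually_gt_atTop 0] with t ht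
    have hr := hrpos t ht
    have hq := hqpos t ht
    field_simp
  have hle : δ ≤ 1 - δ := by linarith
  have hscale : ∀ t, ∫ u in δ * t..(1 - δ) * t, r (t - u) * q u =
      ∫ x in δ..1 - δ, t * (r ((1 - x) * t) * q (x * t)) := by
    intro t
    have h := intervalIntegral.smul_integral_comp_mul_right (a := δ) (b := 1 - δ)
      (fun u => r (t - u) * q u) t
    rw [intervalIntegral.integral_const_mul, ← h, smul_eq_mul]
    simp only [sub_mul, one_mul]
  simp only [hscale]
  refine intervalIntegral.tendsto_integral_filter_of_dominated_convergence
    (fun _ => K * δ ^ (-θ) * δ ^ (-ρ) + 1) ?_ ?_ intervalIntegrable_const ?_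
  · filter_upwards [eventually_gt_atTop 0] with t ht
    rw [uIoc_of_le hle]
    refine (AEMeasurable.const_mul (.mul ?_ ?_) t).aestronglyMeasurable
    · refine aemeasurable_restrict_of_monotoneOn measurableSet_Ioc fun x hx y hy hxy => ?_
      refine hranti (mem_Ioi.2 (mul_pos ?_ ht)) (mem_Ioi.2 (mul_pos ?_ ht)) (by gcongr)
      · linarith [hy.2]
      · linarith [hx.2]
    · refine aemeasurable_restrict_of_antitoneOn measurableSet_Ioc fun x hx y hy hxy => ?_
      exact hqanti (mem_Ioi.2 (mul_pos (hδ.trans hx.1) ht))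
        (mem_Ioi.2 (mul_pos (hδ.trans hy.1) ht)) (by gcongr)
  · filter_upwards [eventually_gt_atTop 0,
      (hratio δ hδ δ hδ).eventually_le_const (lt_add_one _)] with t ht hbd
    refine .of_forall fun x hx => ?_
    rw [uIoc_of_le hle] at hx
    have hx1 : δ ≤ 1 - x := by linarith [hx.2]
    have hδt : 0 < δ * t := mul_pos hδ ht
    have h1 : δ * t ≤ (1 - x) * t := by gcongr
    have h2 : δ * t ≤ x * t := by have := hx.1.le; gcongr
    have hr0 := hrpos _ (hδt.trans_le h1)
    have hq0 := hqpos _ (hδt.trans_le h2)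
    have hr1 := hranti (mem_Ioi.2 hδt) (mem_Ioi.2 (hδt.trans_le h1)) h1
    have hq1 := hqanti (mem_Ioi.2 hδt) (mem_Ioi.2 (hδt.trans_le h2)) h2
    rw [Real.norm_of_nonneg (by positivity)]
    refine le_trans ?_ hbd
    have := hrpos _ hδt
    gcongr
  · refine .of_forall fun x hx => ?_
    rw [uIoc_of_le hle] at hx
    exact hratio (1 - x) (by linarith [hx.2]) x (hδ.trans hx.1)

open MeasureTheory Set in
theorem intervalIntegrable_one_sub_rpow_mul_rpow {s : ℝ} (hs : 0 < s) (hs1 : s < 1) :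
    IntervalIntegrable (fun x : ℝ => (1 - x) ^ (-s) * x ^ (s - 1)) volume 0 1 := by
  have h := (Complex.betaIntegral_convergent (u := s) (v := (1 - s : ℝ)) (by simpa)
    (by simpa using hs1)).norm
  rw [intervalIntegrable_iff_integrableOn_Ioo_of_le zero_le_one] at h ⊢
  refine h.congr_fun (fun x hx => ?_) measurableSet_Ioo
  have h1 : ((1 : ℂ) - x) = ((1 - x : ℝ) : ℂ) := by push_cast; rfl
  simp only
  rw [h1, norm_mul, Complex.norm_cpow_eq_rpow_re_of_pos hx.1,
    Complex.norm_cpow_eq_rpow_re_of_pos (by linarith [hx.2])]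
  simp [mul_comm]

open MeasureTheory Set in
theorem integral_one_sub_rpow_mul_rpow {s : ℝ} (hs : 0 < s) (hs1 : s < 1) :
    ∫ x in (0 : ℝ)..1, (1 - x) ^ (-s) * x ^ (s - 1) = Real.pi / Real.sin (Real.pi * s) := by
  have h1s : 0 < 1 - s := by linarith
  have hbeta : ((∫ x in (0 : ℝ)..1, (1 - x) ^ (-s) * x ^ (s - 1) : ℝ) : ℂ) =
      Complex.betaIntegral s (1 - s : ℝ) := by
    rw [Complex.betaIntegral, ← intervalIntegral.integral_ofReal]
    refine intervalIntegral.integral_congr fun x hx => ?_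
    rw [uIcc_of_le zero_le_one] at hx
    have h1x : 0 ≤ 1 - x := by linarith [hx.2]
    rw [Complex.ofReal_mul, Complex.ofReal_cpow hx.1, Complex.ofReal_cpow h1x]
    push_cast
    rw [mul_comm]
    congr 2
    ring
  have h := congrArg Complex.re hbeta
  rw [Complex.ofReal_re, ← ProbabilityTheory.beta_eq_betaIntegralReal s (1 - s) hs h1s] at h
  rw [h, ProbabilityTheory.beta, add_sub_cancel, Real.Gamma_one, div_one,
    Real.Gamma_mul_Gamma_one_sub]

open Filter MeasureTheory Set Topology in
/-- Truncating an integrable function on `[0, 1]` symmetrically approximates its integral. -/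
theorem tendsto_integral_symm_truncation {f : ℝ → ℝ} (hf : IntervalIntegrable f volume 0 1) :
    Tendsto (fun δ => ∫ x in δ..1 - δ, f x) (𝓝[>] 0) (𝓝 (∫ x in (0 : ℝ)..1, f x)) := by
  have hcont := intervalIntegral.continuousOn_primitive_interval' hf left_mem_uIcc
  rw [uIcc_of_le zero_le_one] at hcont
  have hmem : ∀ᶠ δ : ℝ in 𝓝[>] 0, δ ∈ Icc (0 : ℝ) 1 :=
    mem_of_superset (Ioo_mem_nhdsGT zero_lt_one) Ioo_subset_Icc_self
  have h0 : Tendsto (fun δ => ∫ x in (0 : ℝ)..δ, f x) (𝓝[>] 0) (𝓝 0) := by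
    have := (hcont 0 (by simp)).tendsto.comp
      (tendsto_nhdsWithin_iff.2 ⟨tendsto_nhdsWithin_of_tendsto_nhds tendsto_id, hmem⟩)
    simpa [Function.comp_def] using this
  have hsub : Tendsto (fun δ : ℝ => 1 - δ) (𝓝[>] 0) (𝓝 1) := by
    have : Tendsto (fun δ : ℝ => 1 - δ) (𝓝 0) (𝓝 (1 - 0)) := tendsto_const_nhds.sub tendsto_id
    rw [sub_zero] at this
    exact tendsto_nhdsWithin_of_tendsto_nhds this
  have hmem' : ∀ᶠ δ : ℝ in 𝓝[>] 0, 1 - δ ∈ Icc (0 : ℝ) 1 :=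
    hmem.mono fun δ hδ => ⟨by linarith [hδ.2], by linarith [hδ.1]⟩
  have h1 := (hcont 1 (by simp)).tendsto.comp (tendsto_nhdsWithin_iff.2 ⟨hsub, hmem'⟩)
  have h := h1.sub h0
  rw [sub_zero] at h
  refine h.congr' ?_
  filter_upwards [hmem, hmem'] with δ hδ hδ'
  refine intervalIntegral.integral_interval_sub_left (hf.mono_set ?_) (hf.mono_set ?_) <;>
    rw [uIcc_of_le zero_le_one]
  · rw [uIcc_of_le hδ'.1]; exact Icc_subset_Icc_right hδ'.2
  · rw [uIcc_of_le hδ.1]; exact Icc_subset_Icc_right hδ.2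

open Filter MeasureTheory Set Topology in
/-- Convolution of decreasing regularly varying functions in the balanced case. -/
theorem tendsto_convolution_of_regularlyVarying {r q : ℝ → ℝ} {θ ρ K : ℝ} (hθ0 : 0 < θ)
    (hθ : θ < 1) (hρ : ρ < 1) (hsum : θ + ρ = 1) (hK : 0 < K)
    (hrpos : ∀ t > (0 : ℝ), 0 < r t) (hqpos : ∀ t > (0 : ℝ), 0 < q t)
    (hranti : AntitoneOn r (Ioi 0)) (hqanti : AntitoneOn q (Ioi 0))
    (hrint : ∀ t > (0 : ℝ), IntegrableOn r (Ioc 0 t))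
    (hqint : ∀ t > (0 : ℝ), IntegrableOn q (Ioc 0 t))
    (hrrv : ∀ c > (0 : ℝ), Tendsto (fun t => r (c * t) / r t) atTop (𝓝 (c ^ (-θ))))
    (hqrv : ∀ c > (0 : ℝ), Tendsto (fun t => q (c * t) / q t) atTop (𝓝 (c ^ (-ρ))))
    (hlim : Tendsto (fun t => t * r t * q t) atTop (𝓝 K)) :
    Tendsto (fun t => ∫ u in (0 : ℝ)..t, r (t - u) * q u) atTop
      (𝓝 (K * Real.pi / Real.sin (Real.pi * θ))) := by
  have hρθ : -ρ = θ - 1 := by linarith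
  obtain ⟨C₁, hC₁, hedge₁⟩ :=
    eventually_convolution_edge_le hρ hK hrpos hqpos hranti hqanti hqint hrrv hqrv hlim
  obtain ⟨C₂, hC₂, hedge₂⟩ :=
    eventually_convolution_edge_le hθ hK hqpos hrpos hqanti hranti hrint hqrv hrrv
      (hlim.congr fun t => by ring)
  set B : ℝ := K * Real.pi / Real.sin (Real.pi * θ) with hB
  have htrunc : Tendsto (fun δ => ∫ x in δ..1 - δ, K * (1 - x) ^ (-θ) * x ^ (-ρ)) (𝓝[>] 0)
      (𝓝 B) := by
    have h := tendsto_integral_symm_truncation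
      ((intervalIntegrable_one_sub_rpow_mul_rpow hθ0 hθ).const_mul K)
    rw [intervalIntegral.integral_const_mul, integral_one_sub_rpow_mul_rpow hθ0 hθ,
      ← mul_div_assoc] at h
    simpa only [hρθ, mul_assoc] using h
  have hsmall : ∀ (C s : ℝ), 0 < s → Tendsto (fun δ : ℝ => C * δ ^ s) (𝓝[>] 0) (𝓝 0) := by
    intro C s hs
    have h : Tendsto (fun δ : ℝ => C * δ ^ s) (𝓝 0) (𝓝 (C * 0 ^ s)) :=
      ((Real.continuousAt_rpow_const 0 s (.inr hs.le)).tendsto).const_mul C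
    rw [Real.zero_rpow hs.ne', mul_zero] at h
    exact tendsto_nhdsWithin_of_tendsto_nhds h
  refine Metric.tendsto_nhds.2 fun ε hε => ?_
  have hε4 : 0 < ε / 4 := by positivity
  obtain ⟨δ, hBδ, hδ₁, hδ₂, hδ0, hδ2⟩ :=
    ((Metric.tendsto_nhds.1 htrunc _ hε4).and
      (((hsmall C₁ (1 - ρ) (by linarith)).eventually_lt_const hε4).and
      (((hsmall C₂ (1 - θ) (by linarith)).eventually_lt_const hε4).and
      (Ioo_mem_nhdsGT (show (0 : ℝ) < 1 / 2 by norm_num))))).exists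
  have hmid := tendsto_convolution_middle hδ0 hδ2.le hrpos hqpos hranti hqanti hrrv hqrv hlim
  filter_upwards [Metric.tendsto_nhds.1 hmid _ hε4, hedge₁ δ hδ0 hδ2.le, hedge₂ δ hδ0 hδ2.le,
    eventually_gt_atTop 0] with t hm h1 h2 ht
  have hδt : 0 < δ * t := mul_pos hδ0 ht
  have hδt2 : δ * t < 1 / 2 * t := by gcongr
  have hsplit : (1 - δ) * t = t - δ * t := by ring
  have hi1 := intervalIntegrable_comp_sub_mul_of_antitoneOn (q := q) hδt.le
    (show δ * t < t by linarith) hrpos hranti hqint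
  have hi2 := intervalIntegrable_comp_sub_mul_of_antitoneOn (q := q)
    (show 0 ≤ (1 - δ) * t by linarith) (show (1 - δ) * t < t by linarith) hrpos hranti hqint
  have hi3 : IntervalIntegrable (fun u => r (t - u) * q u) volume ((1 - δ) * t) t := by
    have h := (intervalIntegrable_comp_sub_mul_of_antitoneOn (q := r) hδt.le
      (show δ * t < t by linarith) hqpos hqanti hrint).comp_sub_left t
    simp only [sub_sub_cancel, sub_zero, mul_comm (q _)] at h
    rw [hsplit]
    exact h.symm
  have hadd := intervalIntegral.integral_add_adjacent_intervals hi2 hi3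
  have hadd' := intervalIntegral.integral_add_adjacent_intervals hi1 (hi1.symm.trans hi2)
  have hflip : ∫ u in (1 - δ) * t..t, r (t - u) * q u = ∫ u in (0 : ℝ)..δ * t, q (t - u) * r u := by
    have h := intervalIntegral.integral_comp_sub_left (a := 0) (b := δ * t)
      (fun u => r (t - u) * q u) t
    simp only [sub_sub_cancel, sub_zero] at h
    rw [hsplit, ← h]
    simp only [mul_comm]
  rw [← hflip] at h2
  have hn1 : 0 ≤ ∫ u in (0 : ℝ)..δ * t, r (t - u) * q u := by
    rw [intervalIntegral.integral_of_le hδt.le]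
    exact setIntegral_nonneg measurableSet_Ioc fun x hx =>
      (mul_pos (hrpos _ (by linarith [hx.2])) (hqpos x hx.1)).le
  have hn2 : 0 ≤ ∫ u in (1 - δ) * t..t, r (t - u) * q u := by
    rw [intervalIntegral.integral_of_le (by linarith), integral_Ioc_eq_integral_Ioo]
    exact setIntegral_nonneg measurableSet_Ioo fun x hx =>
      (mul_pos (hrpos _ (by linarith [hx.2])) (hqpos x (by linarith [hx.1]))).le
  rw [Real.dist_eq, abs_lt] at hm hBδ ⊢
  constructor <;> linarith


open Filter MeasureTheory Real in
theorem stmt7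
    (θ ρ : ℝ) (hθpos : 0 < θ) (hρpos : 0 < ρ)
    (r q : ℝ → ℝ)
    (hrpos : ∀ t > (0:ℝ), 0 < r t) (hqpos : ∀ t > (0:ℝ), 0 < q t)
    (hranti : AntitoneOn r (Set.Ioi 0)) (hqanti : AntitoneOn q (Set.Ioi 0))
    (hrint : ∀ t > (0:ℝ), MeasureTheory.IntegrableOn r (Set.Ioc 0 t))
    (hqint : ∀ t > (0:ℝ), MeasureTheory.IntegrableOn q (Set.Ioc 0 t))
    (hrrv : ∀ c > (0:ℝ), Filter.Tendsto (fun t => r (c * t) / r t) Filter.atTop (nhds (c ^ (-θ))))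
    (hqrv : ∀ c > (0:ℝ), Filter.Tendsto (fun t => q (c * t) / q t) Filter.atTop (nhds (c ^ (-ρ))))
    (R Q I P : ℝ → ℝ)
    (hR : ∀ t, R t = ∫ u in (0:ℝ)..t, r u)
    (hQ : ∀ t, Q t = ∫ u in (0:ℝ)..t, q u)
    (hI : ∀ t, I t = ∫ u in (0:ℝ)..t, r (t - u) * q u)
    (hP : ∀ t, P t = 1 - Real.exp (-(I t)))
    (hθ : θ < 1) (hρ : ρ < 1) (hsum : θ + ρ = 1)
    (K : ℝ) (hK : 0 < K)
    (hlim : Filter.Tendsto (fun t => t * r t * q t) Filter.atTop (nhds K)) :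
    Filter.Tendsto I Filter.atTop (nhds (K * Real.pi / Real.sin (Real.pi * θ)))
    ∧ Filter.Tendsto P Filter.atTop
        (nhds (1 - Real.exp (-(K * Real.pi / Real.sin (Real.pi * θ))))) := by
  have hconv : Filter.Tendsto I Filter.atTop
      (nhds (K * Real.pi / Real.sin (Real.pi * θ))) := by
    rw [funext hI]
    exact tendsto_convolution_of_regularlyVarying hθpos hθ hρ hsum hK hrpos hqpos hranti hqanti
      hrint hqint hrrv hqrv hlim
  refine ⟨hconv, ?_⟩
  rw [funext hP]
  exact tendsto_const_nhds.sub ((Real.continuous_exp.tendsto _).comp hconv.neg)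
end

section
/- Assume θ ≥ 1 with R∞ := ∫₀^∞ r(u) du < ∞, α/γ ≥ 1 with Q∞ < ∞, and r(t)/q(t) → 0 as t → ∞. Then for every λ > 0, taking s_λ(t) = exp(−λ/W(μt)), one has (1 − Φ(t; s_λ(t)))/(1 − Φ(t;0)) → λ^α (1 + λ^γ)^{−α/γ} as t → ∞; equivalently, the conditional Laplace transform E[exp(−λ Y(t)/W(μt)) | Y(t) > 0] converges to 1 − λ^α (1 + λ^γ)^{−α/γ}. -/
section

open Filter MeasureTheory Set Topology

/-- Regular variation of a monotone function holds uniformly enough to compare its values at any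
two arguments of asymptotic ratio `k`. -/
theorem MonotoneOn.tendsto_div_of_regularlyVarying_s10 {ι : Type*} {F : Filter ι} {f : ℝ → ℝ} {T τ : ℝ}
    (hf : MonotoneOn f (Ici T)) (hpos : ∀ x ∈ Ici T, 0 < f x)
    (hrv : ∀ c > 0, Tendsto (fun t => f (c * t) / f t) atTop (𝓝 (c ^ τ)))
    {x y : ι → ℝ} {k : ℝ} (hk : 0 < k) (hy : Tendsto y F atTop)
    (hxy : Tendsto (fun i => x i / y i) F (𝓝 k)) :
    Tendsto (fun i => f (x i) / f (y i)) F (𝓝 (k ^ τ)) := by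
  have hc : ContinuousAt (fun c : ℝ => c ^ τ) k := Real.continuousAt_rpow_const _ _ (Or.inl hk.ne')
  have hx : Tendsto x F atTop := by
    have := hxy.pos_mul_atTop hk hy
    refine this.congr' ?_
    filter_upwards [hy.eventually_gt_atTop 0] with i hi
    field_simp
  rw [tendsto_order]
  constructor
  · intro b hb
    obtain ⟨c, ⟨hcb, hc0⟩, hck⟩ : ∃ c, (b < c ^ τ ∧ 0 < c) ∧ c < k :=
      (((hc.eventually (lt_mem_nhds hb)).and (lt_mem_nhds hk)).filter_mono
        nhdsWithin_le_nhds |>.and self_mem_nhdsWithin : ∀ᶠ c in 𝓝[<] k, _).exists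
    filter_upwards [((hrv c hc0).comp hy).eventually (lt_mem_nhds hcb),
      hxy.eventually (lt_mem_nhds hck), hy.eventually_ge_atTop T, hy.eventually_gt_atTop 0,
      (hy.const_mul_atTop hc0).eventually_ge_atTop T, hx.eventually_ge_atTop T]
      with i h1 h2 h3 h4 h5 h6
    refine h1.trans_le (div_le_div_of_nonneg_right (hf h5 h6 ?_) (hpos _ h3).le)
    exact ((lt_div_iff₀ h4).1 h2).le
  · intro b hb
    obtain ⟨c, ⟨hcb, hc0⟩, hck⟩ : ∃ c, (c ^ τ < b ∧ 0 < c) ∧ k < c :=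
      (((hc.eventually (gt_mem_nhds hb)).and (lt_mem_nhds hk)).filter_mono
        nhdsWithin_le_nhds |>.and self_mem_nhdsWithin : ∀ᶠ c in 𝓝[>] k, _).exists
    filter_upwards [((hrv c hc0).comp hy).eventually (gt_mem_nhds hcb),
      hxy.eventually (gt_mem_nhds hck), hy.eventually_ge_atTop T, hy.eventually_gt_atTop 0,
      (hy.const_mul_atTop hc0).eventually_ge_atTop T, hx.eventually_ge_atTop T]
      with i h1 h2 h3 h4 h5 h6
    refine lt_of_le_of_lt (div_le_div_of_nonneg_right (hf h6 h5 ?_) (hpos _ h3).le) h1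
    exact ((div_lt_iff₀ h4).1 h2).le

/-- The quotient of two functions, the denominator tending to infinity, has the same limit as the
quotient of their derivatives. -/
theorem tendsto_div_atTop_of_tendsto_deriv_div {f g f' g' : ℝ → ℝ} {T k : ℝ}
    (hf : ∀ x > T, HasDerivAt f (f' x) x) (hg : ∀ x > T, HasDerivAt g (g' x) x)
    (hg' : ∀ x > T, 0 < g' x) (hgtop : Tendsto g atTop atTop)
    (h : Tendsto (fun x => f' x / g' x) atTop (𝓝 k)) :
    Tendsto (fun x => f x / g x) atTop (𝓝 k) := by
  have key : ∀ (h h' : ℝ → ℝ), (∀ x > T, HasDerivAt h (h' x) x) → ∀ b,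
      (∃ S > T, ∀ x ≥ S, 0 ≤ h' x - b * g' x) → ∀ ε > 0, ∀ᶠ x in atTop, b - ε < h x / g x := by
    rintro h h' hh b ⟨S, hST, hS⟩ ε hε
    have hmono : MonotoneOn (fun x => h x - b * g x) (Ici S) := by
      have hd : ∀ x ∈ Ici S, HasDerivAt (fun x => h x - b * g x) (h' x - b * g' x) x :=
        fun x hx => (hh x (hST.trans_le hx)).sub ((hg x (hST.trans_le hx)).const_mul b)
      refine monotoneOn_of_deriv_nonneg (convex_Ici S)
        (fun x hx => (hd x hx).continuousAt.continuousWithinAt)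
        (fun x hx => (hd x (interior_subset hx)).differentiableAt.differentiableWithinAt) ?_
      intro x hx
      rw [(hd x (interior_subset hx)).deriv]
      exact hS x (interior_subset hx)
    have hlim : Tendsto (fun x => (h S - b * g S) / g x) atTop (𝓝 0) :=
      tendsto_const_nhds.div_atTop hgtop
    filter_upwards [hgtop.eventually_gt_atTop 0, eventually_ge_atTop S,
      hlim.eventually (lt_mem_nhds (neg_lt_zero.2 hε))] with x hx hxS hxl
    have h1 : h S - b * g S ≤ h x - b * g x := hmono self_mem_Ici hxS hxS
    rw [lt_div_iff₀ hx] at hxl ⊢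
    linarith
  rw [tendsto_order]
  constructor
  · intro b hb
    obtain ⟨c, hbc, hck⟩ := exists_between hb
    obtain ⟨S, hS⟩ := eventually_atTop.1
      ((h.eventually (lt_mem_nhds hck)).and (eventually_gt_atTop T))
    have := key f f' hf c ⟨S, (hS S le_rfl).2, fun x hx => by
      have h1 := (hS x hx).1
      rw [lt_div_iff₀ (hg' x (hS x hx).2)] at h1
      linarith⟩ (c - b) (sub_pos.2 hbc)
    simpa using this
  · intro b hb
    obtain ⟨c, hkc, hcb⟩ := exists_between hb
    obtain ⟨S, hS⟩ := eventually_atTop.1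
      ((h.eventually (gt_mem_nhds hkc)).and (eventually_gt_atTop T))
    have := key (fun x => -f x) (fun x => -f' x) (fun x hx => (hf x hx).neg) (-c)
      ⟨S, (hS S le_rfl).2, fun x hx => by
        have h1 := (hS x hx).1
        rw [div_lt_iff₀ (hg' x (hS x hx).2)] at h1
        linarith⟩ (b - c) (sub_pos.2 hcb)
    filter_upwards [this] with x hx
    rw [neg_div] at hx
    linarith

/-- If the kernel `p` is eventually antitone, of dominated variation and dominates `r`, then the
shifted convolution of `r` and `p` is asymptotic to a multiple of `p`. -/
theorem tendsto_convolution_div {r p a : ℝ → ℝ} {T C K : ℝ}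
    (hr : IntegrableOn r (Ioi 0)) (hrpos : ∀ t > 0, 0 < r t) (hranti : AntitoneOn r (Ioi 0))
    (hp : Integrable p) (hppos : ∀ u ∈ Ici T, 0 < p u) (hpanti : AntitoneOn p (Ici T))
    (hC : ∀ᶠ t in atTop, p (t / 2) ≤ C * p t)
    (hrp : Tendsto (fun t => r t / p t) atTop (𝓝 0)) (ha : ∀ᶠ t in atTop, 0 ≤ a t)
    (hK : ∀ v > 0, Tendsto (fun t => p (t - v + a t) / p t) atTop (𝓝 K)) :
    Tendsto (fun t => (∫ u in (0 : ℝ)..t, r (t - u) * p (u + a t)) / p t) atTop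
      (𝓝 ((∫ u in Ioi 0, r u) * K)) := by
  have hhalf : Tendsto (fun t : ℝ => t / 2) atTop atTop := tendsto_id.atTop_div_const two_pos
  have hmeas : ∀ t, AEStronglyMeasurable (fun v => p (t - v + a t)) volume := fun t => by
    have := (hp.comp_sub_left (t + a t)).aestronglyMeasurable
    refine this.congr (ae_of_all _ fun v => ?_)
    simp only
    congr 1
    ring
  -- the part of the integral where the argument of `p` is large
  have hbound : ∀ᶠ t in atTop, ∀ v ∈ Ioc 0 (t / 2), ‖p (t - v + a t)‖ ≤ C * p t := by
    filter_upwards [hC, ha, hhalf.eventually_ge_atTop T] with t h1 h2 h3 v hv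
    have h4 : t / 2 ≤ t - v + a t := by linarith [hv.2]
    rw [Real.norm_of_nonneg (hppos _ (le_trans h3 h4)).le]
    exact (hpanti h3 (le_trans h3 h4) h4).trans h1
  have hfar : Tendsto (fun t => (∫ v in (0 : ℝ)..t / 2, r v * p (t - v + a t)) / p t) atTop
      (𝓝 ((∫ u in Ioi 0, r u) * K)) := by
    have hdct : Tendsto (fun t => ∫ v in Ioi (0 : ℝ),
        (Iic (t / 2)).indicator (fun v => r v * (p (t - v + a t) / p t)) v) atTop
        (𝓝 (∫ v in Ioi 0, r v * K)) := by
      refine tendsto_integral_filter_of_dominated_convergence (fun v => |r v| * C) ?_ ?_ ?_ ?_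
      · filter_upwards with t
        simp only [div_eq_mul_inv]
        exact (hr.aestronglyMeasurable.mul ((hmeas t).restrict.mul_const (p t)⁻¹)).indicator
          measurableSet_Iic
      · filter_upwards [hbound, eventually_ge_atTop T, hC, hhalf.eventually_ge_atTop T]
          with t h1 h2 h3 h5
        have hpt := hppos t h2
        have hC0 : 0 ≤ C := by
          by_contra! h
          nlinarith [hppos _ h5]
        filter_upwards [ae_restrict_mem measurableSet_Ioi] with v hv
        by_cases hv' : v ∈ Iic (t / 2)
        · rw [indicator_of_mem hv', norm_mul, norm_div, Real.norm_of_nonneg hpt.le,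
            Real.norm_eq_abs (r v)]
          gcongr
          exact (div_le_iff₀ hpt).2 (h1 v ⟨hv, hv'⟩)
        · rw [indicator_of_notMem hv', norm_zero]
          positivity
      · exact hr.abs.mul_const C
      · filter_upwards [ae_restrict_mem measurableSet_Ioi] with v hv
        refine ((hK v hv).const_mul (r v)).congr' ?_
        filter_upwards [hhalf.eventually_ge_atTop v] with t ht
        rw [indicator_of_mem (show v ∈ Iic (t / 2) from ht)]
    rw [integral_mul_const] at hdct
    refine hdct.congr' ?_
    filter_upwards [hhalf.eventually_ge_atTop 0] with t ht
    rw [setIntegral_indicator measurableSet_Iic, Ioi_inter_Iic,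
      intervalIntegral.integral_of_le ht, ← integral_div]
    simp only [mul_div_assoc]
  -- the part of the integral where the argument of `r` is large
  have hnearbound : ∀ᶠ t in atTop, ∀ u ∈ Ioc 0 (t / 2), ‖r (t - u)‖ ≤ r (t / 2) := by
    filter_upwards [eventually_gt_atTop 0] with t ht u hu
    have h1 : t / 2 ≤ t - u := by linarith [hu.2]
    have h0 : 0 < t / 2 := by linarith
    rw [Real.norm_of_nonneg (hrpos _ (h0.trans_le h1)).le]
    exact hranti h0 (h0.trans_le h1) h1
  have hnear : Tendsto (fun t => (∫ u in (0 : ℝ)..t / 2, r (t - u) * p (u + a t)) / p t) atTop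
      (𝓝 0) := by
    have hlim : Tendsto (fun t => |r (t / 2) / p (t / 2)| * C * ∫ u, |p u|) atTop (𝓝 0) := by
      simpa using (((hrp.comp hhalf).abs).mul_const C).mul_const (∫ u, |p u|)
    refine squeeze_zero_norm' ?_ hlim
    filter_upwards [hnearbound, hC, eventually_ge_atTop T, hhalf.eventually_ge_atTop T,
      hhalf.eventually_gt_atTop 0] with t h1 h2 h3 h4 h5
    have hpt := hppos t h3
    have hpt2 := hppos _ h4
    have hr2 := hrpos _ h5
    have hint : ‖∫ u in (0 : ℝ)..t / 2, r (t - u) * p (u + a t)‖ ≤ r (t / 2) * ∫ u, |p u| := by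
      have hpa : Integrable (fun u => |p (u + a t)|) := (hp.comp_add_right (a t)).abs
      rw [intervalIntegral.integral_of_le h5.le]
      calc ‖∫ u in Ioc 0 (t / 2), r (t - u) * p (u + a t)‖
          ≤ ∫ u in Ioc 0 (t / 2), r (t / 2) * |p (u + a t)| := by
            refine norm_integral_le_of_norm_le (hpa.integrableOn.const_mul _) ?_
            filter_upwards [ae_restrict_mem measurableSet_Ioc] with u hu
            rw [norm_mul, Real.norm_eq_abs (p _)]
            gcongr
            exact h1 u hu
        _ ≤ ∫ u, r (t / 2) * |p (u + a t)| :=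
            setIntegral_le_integral (hpa.const_mul _) (ae_of_all _ fun u => by positivity)
        _ = r (t / 2) * ∫ u, |p u| := by
            rw [integral_const_mul, integral_add_right_eq_self (fun u => |p u|)]
    have h6 : r (t / 2) / p t ≤ |r (t / 2) / p (t / 2)| * C := by
      rw [abs_of_pos (by positivity), div_mul_eq_mul_div, div_le_div_iff₀ hpt hpt2]
      nlinarith
    rw [norm_div, Real.norm_of_nonneg hpt.le]
    calc _ ≤ r (t / 2) * (∫ u, |p u|) / p t := by gcongr
      _ = r (t / 2) / p t * ∫ u, |p u| := by ring
      _ ≤ _ := by gcongr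
  have := hnear.add hfar
  rw [zero_add] at this
  refine this.congr' ?_
  filter_upwards [hbound, hnearbound, hhalf.eventually_gt_atTop 0] with t h1 h2 h5
  rw [← add_div]
  congr 1
  have hi1 : IntervalIntegrable (fun u => r (t - u) * p (u + a t)) volume 0 (t / 2) := by
    rw [intervalIntegrable_iff_integrableOn_Ioc_of_le h5.le]
    refine Integrable.bdd_mul (c := r (t / 2)) (hp.comp_add_right (a t)).integrableOn ?_ ?_
    · refine (aemeasurable_restrict_of_monotoneOn measurableSet_Ioc ?_).aestronglyMeasurable
      intro u hu v hv huv
      exact hranti (show 0 < t - v by linarith [hv.2]) (show 0 < t - u by linarith [hu.2])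
        (by linarith)
    · filter_upwards [ae_restrict_mem measurableSet_Ioc] with u hu using h2 u hu
  have hi2 : IntervalIntegrable (fun v => r v * p (t - v + a t)) volume 0 (t / 2) := by
    rw [intervalIntegrable_iff_integrableOn_Ioc_of_le h5.le]
    refine Integrable.mul_bdd (c := C * p t) (hr.mono_set Ioc_subset_Ioi_self)
      (hmeas t).restrict ?_
    filter_upwards [ae_restrict_mem measurableSet_Ioc] with u hu using h1 u hu
  have hi3 : IntervalIntegrable (fun u => r (t - u) * p (u + a t)) volume (t / 2) t := by
    have := (hi2.comp_sub_left t).symm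
    simp only [sub_zero, sub_sub_cancel] at this
    rwa [sub_half] at this
  have hsub := intervalIntegral.integral_comp_sub_left (a := t / 2) (b := t)
    (fun v => r v * p (t - v + a t)) t
  simp only [sub_self, sub_sub_cancel, sub_half] at hsub
  rw [← hsub, intervalIntegral.integral_add_adjacent_intervals hi1 hi3]

/-- The integral `∫₁ˣ u ^ (γ - 1) / L u du` is regularly varying with index `γ`. -/
theorem tendsto_integral_rpow_div_of_slowlyVarying {γ : ℝ} {L V : ℝ → ℝ}
    (hLsv : ∀ c > 0, Tendsto (fun t => L (c * t) / L t) atTop (𝓝 1))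
    (hLpos : ∀ x ∈ Ici 1, 0 < L x)
    (hVd : ∀ x > 1, HasDerivAt V (x ^ (γ - 1) / L x) x) (hVtop : Tendsto V atTop atTop)
    {c : ℝ} (hc : 0 < c) :
    Tendsto (fun x => V (c * x) / V x) atTop (𝓝 (c ^ γ)) := by
  have hcx : ∀ x > max 1 c⁻¹, 1 < c * x := fun x hx => by
    have := (max_lt_iff.1 hx).2
    rwa [inv_lt_iff_one_lt_mul₀' hc] at this
  refine tendsto_div_atTop_of_tendsto_deriv_div (T := max 1 c⁻¹)
    (f' := fun x => (c * x) ^ (γ - 1) / L (c * x) * c) (g' := fun x => x ^ (γ - 1) / L x)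
    (fun x hx => ?_) (fun x hx => hVd x (max_lt_iff.1 hx).1) (fun x hx => ?_) hVtop ?_
  · have h := (hVd (c * x) (hcx x hx)).comp x ((hasDerivAt_id x).const_mul c)
    rw [mul_one] at h
    exact h
  · have h1 := (max_lt_iff.1 hx).1
    exact div_pos (Real.rpow_pos_of_pos (by linarith) _) (hLpos x h1.le)
  · have h := ((hLsv c hc).inv₀ one_ne_zero).const_mul (c ^ γ)
    rw [inv_one, mul_one] at h
    refine h.congr' ?_
    filter_upwards [eventually_gt_atTop (max 1 c⁻¹)] with x hx
    have h1 := (max_lt_iff.1 hx).1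
    have hx0 : 0 < x := by linarith
    have h2 := hLpos x h1.le
    have h3 := hLpos (c * x) (hcx x hx).le
    have h4 := Real.rpow_pos_of_pos hx0 (γ - 1)
    rw [Real.mul_rpow hc.le hx0.le, Real.rpow_sub_one hc.ne']
    field_simp

/-- The inverse of a strictly increasing regularly varying function of index `γ > 0` is regularly
varying of index `1 / γ`. -/
theorem tendsto_div_inverse_of_regularlyVarying {γ c : ℝ} {V W : ℝ → ℝ} (hγ : 0 < γ)
    (hVmono : StrictMonoOn V (Ici 1))
    (hVrv : ∀ c > 0, Tendsto (fun x => V (c * x) / V x) atTop (𝓝 (c ^ γ)))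
    (hWmem : ∀ y ∈ Ici 0, W y ∈ Ici 1) (hVW : ∀ y ∈ Ici 0, V (W y) = y)
    (hWtop : Tendsto W atTop atTop) (hc : 0 < c) :
    Tendsto (fun y => W (c * y) / W y) atTop (𝓝 (c ^ (1 / γ))) := by
  have hpow : ∀ k : ℝ, 0 < k → (k ^ γ) ^ (1 / γ) = k := fun k hk => by
    rw [← Real.rpow_mul hk.le, mul_one_div_cancel hγ.ne', Real.rpow_one]
  have hkc : (c ^ (1 / γ)) ^ γ = c := by
    rw [← Real.rpow_mul hc.le, one_div_mul_cancel hγ.ne', Real.rpow_one]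
  have hk0 : 0 < c ^ (1 / γ) := Real.rpow_pos_of_pos hc _
  rw [tendsto_order]
  constructor
  · intro b hb
    obtain ⟨d, hbd, hd⟩ := exists_between (max_lt hb hk0)
    have hd0 : 0 < d := (le_max_right _ _).trans_lt hbd
    have h1 : d ^ γ < c := hkc ▸ Real.rpow_lt_rpow hd0.le hd hγ
    filter_upwards [((hVrv d hd0).comp hWtop).eventually (gt_mem_nhds h1),
      eventually_gt_atTop 0, (hWtop.const_mul_atTop hd0).eventually_ge_atTop 1,
      hWtop.eventually_gt_atTop 0] with y h2 hy h3 h4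
    simp only [Function.comp, hVW y hy.le] at h2
    rw [div_lt_iff₀ hy, ← hVW (c * y) (mul_pos hc hy).le] at h2
    have := (hVmono.lt_iff_lt h3 (hWmem _ (mul_pos hc hy).le)).1 h2
    rw [lt_div_iff₀ h4]
    exact lt_of_le_of_lt (mul_le_mul_of_nonneg_right ((le_max_left _ _).trans hbd.le) h4.le) this
  · intro b hb
    have hb0 : 0 < b := hk0.trans hb
    have h1 : c < b ^ γ := hkc ▸ Real.rpow_lt_rpow hk0.le hb hγ
    filter_upwards [((hVrv b hb0).comp hWtop).eventually (lt_mem_nhds h1),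
      eventually_gt_atTop 0, (hWtop.const_mul_atTop hb0).eventually_ge_atTop 1,
      hWtop.eventually_gt_atTop 0] with y h2 hy h3 h4
    simp only [Function.comp, hVW y hy.le] at h2
    rw [lt_div_iff₀ hy, ← hVW (c * y) (mul_pos hc hy).le] at h2
    have := (hVmono.lt_iff_lt (hWmem _ (mul_pos hc hy).le) h3).1 h2
    rwa [div_lt_iff₀ h4]

/-- First-order expansion of `1 - exp (-x)` along a function tending to zero. -/
theorem tendsto_one_sub_exp_neg_div_s10 {ι : Type*} {F : Filter ι} {A p : ι → ℝ} {k : ℝ}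
    (hA : Tendsto A F (𝓝 0)) (h : Tendsto (fun i => A i / p i) F (𝓝 k)) :
    Tendsto (fun i => (1 - Real.exp (-A i)) / p i) F (𝓝 k) := by
  have hd : HasDerivAt (fun x : ℝ => 1 - Real.exp (-x)) 1 0 := by
    simpa using ((hasDerivAt_neg (0 : ℝ)).exp).const_sub 1
  have hc := (continuousAt_dslope_same.2 hd.differentiableAt).tendsto
  rw [dslope_same, hd.deriv] at hc
  have := h.mul (hc.comp hA)
  rw [mul_one] at this
  refine this.congr fun i => ?_
  have h1 := sub_smul_dslope (fun x : ℝ => 1 - Real.exp (-x)) 0 (A i)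
  simp only [sub_zero, neg_zero, Real.exp_zero, sub_self, smul_eq_mul] at h1
  rw [← h1, Function.comp]
  ring

end


open Filter MeasureTheory Real in
theorem stmt10
    (μ γ α : ℝ) (hμ : 0 < μ) (hγ : γ ∈ Set.Ioc (0:ℝ) 1) (hα : α ∈ Set.Ioc (0:ℝ) 1)
    (L l : ℝ → ℝ)
    (hLpos : ∀ x ∈ Set.Ici (1:ℝ), 0 < L x)
    (hLcont : ContinuousOn L (Set.Ici 1))
    (hLsv : ∀ c > (0:ℝ), Filter.Tendsto (fun t => L (c * t) / L t) Filter.atTop (nhds 1))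
    (hlsv : ∀ c > (0:ℝ), Filter.Tendsto (fun t => l (c * t) / l t) Filter.atTop (nhds 1))
    (V W : ℝ → ℝ)
    (hV : ∀ x ∈ Set.Ici (1:ℝ), V x = ∫ u in (1:ℝ)..x, u ^ (γ - 1) / L u)
    (hVtop : Filter.Tendsto V Filter.atTop Filter.atTop)
    (hWmem : ∀ y ∈ Set.Ici (0:ℝ), W y ∈ Set.Ici (1:ℝ))
    (hVW : ∀ y ∈ Set.Ici (0:ℝ), V (W y) = y)
    (hWV : ∀ x ∈ Set.Ici (1:ℝ), W (V x) = x)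
    (Ψ : ℝ → ℝ)
    (hΨ : ∀ x ∈ Set.Ici (1:ℝ), Ψ x = x ^ α / l x)
    (hΨmono : MonotoneOn Ψ (Set.Ici 1))
    (hΨtop : Filter.Tendsto Ψ Filter.atTop Filter.atTop)
    (q : ℝ → ℝ → ℝ)
    (hq : ∀ t ∈ Set.Ici (0:ℝ), ∀ s ∈ Set.Ico (0:ℝ) 1,
      q t s = 1 / Ψ (W (μ * t + V (1 / (1 - s)))))
    (θ : ℝ) (hθpos : 0 < θ)
    (r : ℝ → ℝ)
    (hrpos : ∀ t > (0:ℝ), 0 < r t)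
    (hranti : AntitoneOn r (Set.Ioi 0))
    (hrint : ∀ t > (0:ℝ), MeasureTheory.IntegrableOn r (Set.Ioc 0 t))
    (hrrv : ∀ c > (0:ℝ), Filter.Tendsto (fun t => r (c * t) / r t) Filter.atTop (nhds (c ^ (-θ))))
    (R Q : ℝ → ℝ)
    (hR : ∀ t, R t = ∫ u in (0:ℝ)..t, r u)
    (hQ : ∀ t, Q t = ∫ u in (0:ℝ)..t, q u 0)
    (I : ℝ → ℝ → ℝ) (hI : ∀ t s, I t s = ∫ u in (0:ℝ)..t, r (t - u) * q u s)
    (Φ : ℝ → ℝ → ℝ) (hΦ : ∀ t s, Φ t s = Real.exp (-(I t s)))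
    (hRfin : MeasureTheory.IntegrableOn r (Set.Ioi 0))
    (Rinf : ℝ) (hRinf : Rinf = ∫ u in Set.Ioi (0:ℝ), r u)
    (hQfin : MeasureTheory.IntegrableOn (fun u => q u 0) (Set.Ioi 0))
    (Qinf : ℝ) (hQinf : Qinf = ∫ u in Set.Ioi (0:ℝ), q u 0)
    (Δ : ℝ → ℝ) (hΔ : ∀ s, Δ s = ∫ u in Set.Ioi (0:ℝ), q u s)
    (hθ : 1 ≤ θ) (hαγ : 1 ≤ α / γ)
    (hrq : Filter.Tendsto (fun t => r t / q t 0) Filter.atTop (nhds 0))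
    (lam : ℝ) (hlam : 0 < lam) :
    Filter.Tendsto
      (fun t => (1 - Φ t (Real.exp (-(lam / W (μ * t))))) / (1 - Φ t 0))
      Filter.atTop (nhds (lam ^ α * (1 + lam ^ γ) ^ (-(α / γ)))) := by
  obtain ⟨hγ0, -⟩ := hγ
  have hg : ContinuousOn (fun u : ℝ => u ^ (γ - 1) / L u) (Set.Ici 1) := by
    refine ContinuousOn.div (fun x hx => ?_) hLcont fun x hx => (hLpos x hx).ne'
    exact (Real.continuousAt_rpow_const _ _
      (Or.inl (zero_lt_one.trans_le hx).ne')).continuousWithinAt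
  have hgpos : ∀ x ∈ Set.Ici (1 : ℝ), 0 < x ^ (γ - 1) / L x := fun x hx =>
    div_pos (Real.rpow_pos_of_pos (zero_lt_one.trans_le hx) _) (hLpos x hx)
  have hgint : ∀ x ∈ Set.Ici (1 : ℝ), ∀ y, x ≤ y →
      IntervalIntegrable (fun u : ℝ => u ^ (γ - 1) / L u) volume x y := fun x hx y hxy =>
    (hg.mono fun z hz => le_trans hx hz.1).intervalIntegrable_of_Icc hxy
  have hVd : ∀ x > 1, HasDerivAt V (x ^ (γ - 1) / L x) x := by
    intro x hx
    have hc : ContinuousOn (fun u : ℝ => u ^ (γ - 1) / L u) (Set.Ioi 1) :=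
      hg.mono Set.Ioi_subset_Ici_self
    refine (intervalIntegral.integral_hasDerivAt_right (hgint 1 Set.self_mem_Ici x hx.le)
      (hc.stronglyMeasurableAtFilter isOpen_Ioi x hx)
      (hc.continuousAt (Ioi_mem_nhds hx))).congr_of_eventuallyEq ?_
    filter_upwards [Ioi_mem_nhds hx] with y hy using hV y (Set.Ioi_subset_Ici_self hy)
  have hVmono : StrictMonoOn V (Set.Ici 1) := by
    intro x hx y hy hxy
    rw [hV x hx, hV y hy, ← sub_pos,
      intervalIntegral.integral_interval_sub_left (hgint 1 Set.self_mem_Ici y hy)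
        (hgint 1 Set.self_mem_Ici x hx)]
    exact intervalIntegral.intervalIntegral_pos_of_pos_on (hgint x hx y hxy.le)
      (fun z hz => hgpos z (le_trans hx hz.1.le)) hxy
  have hV1 : V 1 = 0 := by rw [hV 1 Set.self_mem_Ici, intervalIntegral.integral_same]
  have hVpos : ∀ x > 1, 0 < V x := fun x hx =>
    hV1 ▸ hVmono Set.self_mem_Ici (le_of_lt hx) hx
  have hVnonneg : ∀ x ∈ Set.Ici (1 : ℝ), 0 ≤ V x := fun x hx =>
    hV1 ▸ hVmono.monotoneOn Set.self_mem_Ici hx hx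
  have hVrv : ∀ c > 0, Tendsto (fun x => V (c * x) / V x) atTop (nhds (c ^ γ)) := fun c hc =>
    tendsto_integral_rpow_div_of_slowlyVarying hLsv hLpos hVd hVtop hc
  have hWmono : MonotoneOn W (Set.Ici 0) := by
    intro x hx y hy hxy
    rw [← hVmono.le_iff_le (hWmem x hx) (hWmem y hy), hVW x hx, hVW y hy]
    exact hxy
  have hWtop : Tendsto W atTop atTop := by
    refine tendsto_atTop.2 fun M => ?_
    have h1 : max M 1 ∈ Set.Ici (1 : ℝ) := Set.mem_Ici.2 (le_max_right _ _)
    filter_upwards [eventually_ge_atTop (V (max M 1))] with y hy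
    have := hWmono (hVnonneg _ h1) ((hVnonneg _ h1).trans hy) hy
    rw [hWV _ h1] at this
    exact (le_max_left _ _).trans this
  have hWrv : ∀ c > 0, Tendsto (fun y => W (c * y) / W y) atTop (nhds (c ^ (1 / γ))) :=
    fun c hc => tendsto_div_inverse_of_regularlyVarying hγ0 hVmono hVrv hWmem hVW hWtop hc
  obtain ⟨T, hT⟩ := eventually_atTop.1
    ((hΨtop.eventually_gt_atTop 0).and (eventually_ge_atTop (1 : ℝ)))
  have hΨpos : ∀ x ∈ Set.Ici T, 0 < Ψ x := fun x hx => (hT x hx).1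
  have hT1 : 1 ≤ T := (hT T le_rfl).2
  have hΨmonoT : MonotoneOn Ψ (Set.Ici T) := hΨmono.mono (Set.Ici_subset_Ici.2 hT1)
  have hΨrv : ∀ c > 0, Tendsto (fun x => Ψ (c * x) / Ψ x) atTop (nhds (c ^ α)) := by
    intro c hc
    have h := ((hlsv c hc).inv₀ one_ne_zero).const_mul (c ^ α)
    rw [inv_one, mul_one] at h
    refine h.congr' ?_
    filter_upwards [eventually_ge_atTop 1,
      (tendsto_id.const_mul_atTop hc).eventually_ge_atTop 1] with x h1 h2
    have hx0 : 0 < x := by linarith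
    have h3 := (Real.rpow_pos_of_pos hx0 α).ne'
    rw [hΨ x h1, hΨ (c * x) h2, Real.mul_rpow hc.le hx0.le, inv_div, div_div_div_eq,
      mul_assoc, mul_div_assoc, mul_comm (l (c * x)), mul_div_mul_left _ _ h3]
  have hμtop : Tendsto (fun t => μ * t) atTop atTop := tendsto_id.const_mul_atTop hμ
  have hWμtop : Tendsto (fun t => W (μ * t)) atTop atTop := hWtop.comp hμtop
  -- the kernel `q (·, 0)`, extended by zero
  set p : ℝ → ℝ := (Set.Ioi 0).indicator fun u => q u 0 with hpdef
  have hp_eq : ∀ u > 0, p u = (Ψ (W (μ * u)))⁻¹ := by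
    intro u hu
    rw [hpdef, Set.indicator_of_mem (show u ∈ Set.Ioi 0 from hu),
      hq u (le_of_lt hu) 0 ⟨le_rfl, one_pos⟩, sub_zero, div_one, hV1, add_zero, one_div]
  have hp_int : Integrable p := hQfin.integrable_indicator measurableSet_Ioi
  have hp_ratio : ∀ (x : ℝ → ℝ) (k : ℝ), 0 < k → Tendsto (fun t => x t / t) atTop (nhds k) →
      Tendsto (fun t => p (x t) / p t) atTop (nhds (k ^ (-(α / γ)))) := by
    intro x k hk hx
    have h1 : Tendsto (fun t => W (μ * x t) / W (μ * t)) atTop (nhds (k ^ (1 / γ))) := by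
      refine hWmono.tendsto_div_of_regularlyVarying_s10
        (fun y hy => zero_lt_one.trans_le (hWmem y hy)) hWrv hk hμtop (hx.congr fun t => ?_)
      rw [mul_div_mul_left _ _ hμ.ne']
    have h2 := (hΨmonoT.tendsto_div_of_regularlyVarying_s10 hΨpos hΨrv
      (Real.rpow_pos_of_pos hk _) hWμtop h1).inv₀
        (Real.rpow_pos_of_pos (Real.rpow_pos_of_pos hk _) _).ne'
    rw [← Real.rpow_mul hk.le, one_div_mul_eq_div, ← Real.rpow_neg hk.le] at h2
    refine h2.congr' ?_
    filter_upwards [eventually_gt_atTop 0, hx.eventually (lt_mem_nhds hk)] with t ht hxt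
    rw [hp_eq t ht, hp_eq (x t) ((div_pos_iff_of_pos_right ht).1 hxt), inv_div, inv_div_inv]
  obtain ⟨S, hS⟩ := eventually_atTop.1
    ((hWμtop.eventually_ge_atTop T).and (eventually_gt_atTop (0 : ℝ)))
  have hp_pos : ∀ u ∈ Set.Ici S, 0 < p u := fun u hu => by
    rw [hp_eq u (hS u hu).2]
    exact inv_pos.2 (hΨpos _ (hS u hu).1)
  have hp_anti : AntitoneOn p (Set.Ici S) := by
    intro u hu v hv huv
    rw [hp_eq u (hS u hu).2, hp_eq v (hS v hv).2]
    refine inv_anti₀ (hΨpos _ (hS u hu).1) (hΨmonoT (hS u hu).1 (hS v hv).1 ?_)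
    exact hWmono (mul_pos hμ (hS u hu).2).le (mul_pos hμ (hS v hv).2).le
      (mul_le_mul_of_nonneg_left huv hμ.le)
  have hp_zero : Tendsto p atTop (nhds 0) := by
    refine (tendsto_inv_atTop_zero.comp (hΨtop.comp hWμtop)).congr' ?_
    filter_upwards [eventually_gt_atTop 0] with t ht
    exact (hp_eq t ht).symm
  have hp_half : ∀ᶠ t in atTop, p (t / 2) ≤ ((1 / 2 : ℝ) ^ (-(α / γ)) + 1) * p t := by
    have h1 := hp_ratio (fun t => t / 2) (1 / 2) (by norm_num) (by
      refine tendsto_const_nhds.congr' ?_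
      filter_upwards [eventually_gt_atTop 0] with t ht
      field_simp)
    filter_upwards [h1.eventually (gt_mem_nhds (lt_add_one _)), eventually_ge_atTop S]
      with t h2 h3
    exact ((div_lt_iff₀ (hp_pos t h3)).1 h2).le
  have hrp : Tendsto (fun t => r t / p t) atTop (nhds 0) := by
    refine hrq.congr' ?_
    filter_upwards [eventually_gt_atTop 0] with t ht
    rw [hpdef, Set.indicator_of_mem (show t ∈ Set.Ioi 0 from ht)]
  have hconv : ∀ (a : ℝ → ℝ) (κ : ℝ), 0 ≤ κ → (∀ᶠ t in atTop, 0 ≤ a t) →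
      Tendsto (fun t => a t / t) atTop (nhds κ) →
      Tendsto (fun t => (∫ u in (0 : ℝ)..t, r (t - u) * p (u + a t)) / p t) atTop
        (nhds ((∫ u in Set.Ioi 0, r u) * (1 + κ) ^ (-(α / γ)))) := by
    intro a κ hκ ha haκ
    refine tendsto_convolution_div hRfin hrpos hranti hp_int hp_pos hp_anti hp_half hrp ha
      fun v _ => hp_ratio _ _ (by positivity) ?_
    have h1 : Tendsto (fun t : ℝ => v / t) atTop (nhds 0) :=
      tendsto_const_nhds.div_atTop tendsto_id
    have h2 := (h1.const_sub 1).add haκ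
    rw [sub_zero] at h2
    refine h2.congr' ?_
    filter_upwards [eventually_gt_atTop 0] with t ht
    field_simp
  have hquot : ∀ (a : ℝ → ℝ) (s : ℝ → ℝ) (κ : ℝ), 0 ≤ κ → (∀ᶠ t in atTop, 0 ≤ a t) →
      Tendsto (fun t => a t / t) atTop (nhds κ) →
      (∀ᶠ t in atTop, ∀ u > 0, q u (s t) = p (u + a t)) →
      Tendsto (fun t => (1 - Φ t (s t)) / p t) atTop
        (nhds ((∫ u in Set.Ioi 0, r u) * (1 + κ) ^ (-(α / γ)))) := by
    intro a s κ hκ ha haκ hs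
    have h1 : Tendsto (fun t => I t (s t) / p t) atTop
        (nhds ((∫ u in Set.Ioi 0, r u) * (1 + κ) ^ (-(α / γ)))) := by
      refine (hconv a κ hκ ha haκ).congr' ?_
      filter_upwards [hs, eventually_ge_atTop 0] with t h2 ht
      rw [hI, intervalIntegral.integral_of_le ht, intervalIntegral.integral_of_le ht]
      congr 1
      refine setIntegral_congr_fun measurableSet_Ioc fun u hu => ?_
      simp only [h2 u hu.1]
    have h2 : Tendsto (fun t => I t (s t)) atTop (nhds 0) := by
      have h3 := h1.mul hp_zero
      rw [mul_zero] at h3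
      refine h3.congr' ?_
      filter_upwards [eventually_ge_atTop S] with t ht
      exact div_mul_cancel₀ _ (hp_pos t ht).ne'
    simp only [hΦ]
    exact tendsto_one_sub_exp_neg_div_s10 h2 h1
  have hRpos : 0 < ∫ u in Set.Ioi 0, r u := by
    rw [setIntegral_pos_iff_support_of_nonneg_ae _ hRfin]
    · have hsub : Set.Ioi 0 ⊆ Function.support r := fun u hu => (hrpos u hu).ne'
      rw [Set.inter_eq_right.2 hsub, Real.volume_Ioi]
      exact ENNReal.zero_lt_top
    · filter_upwards [ae_restrict_mem measurableSet_Ioi] with u hu using (hrpos u hu).le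
  have hden := hquot (fun _ => 0) (fun _ => 0) 0 le_rfl (Eventually.of_forall fun _ => le_rfl)
    (by simp) (Eventually.of_forall fun t u hu => by
      rw [add_zero, hpdef, Set.indicator_of_mem (show u ∈ Set.Ioi 0 from hu)])
  rw [add_zero, Real.one_rpow, mul_one] at hden
  -- the shift produced by the argument `s`
  set s : ℝ → ℝ := fun t => Real.exp (-(lam / W (μ * t))) with hs
  have hs_mem : ∀ᶠ t in atTop, s t ∈ Set.Ioo (0 : ℝ) 1 := by
    filter_upwards [hWμtop.eventually_gt_atTop 0] with t ht
    exact ⟨Real.exp_pos _, Real.exp_lt_one_iff.2 (neg_neg_of_pos (div_pos hlam ht))⟩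
  have hs_inv : ∀ᶠ t in atTop, 1 ≤ 1 / (1 - s t) := by
    filter_upwards [hs_mem] with t ht
    rw [le_div_iff₀ (sub_pos.2 ht.2)]
    linarith [ht.1]
  have hs_lim : Tendsto (fun t => 1 / (1 - s t) / W (μ * t)) atTop (nhds lam⁻¹) := by
    have h1 : Tendsto (fun t => lam / W (μ * t)) atTop (nhds 0) :=
      tendsto_const_nhds.div_atTop hWμtop
    have h2 : Tendsto (fun t => (1 - s t) / (1 / W (μ * t))) atTop (nhds lam) := by
      refine tendsto_one_sub_exp_neg_div_s10 h1 (tendsto_const_nhds.congr' ?_)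
      filter_upwards [hWμtop.eventually_gt_atTop 0] with t ht
      field_simp
    refine (h2.inv₀ hlam.ne').congr fun t => ?_
    rw [inv_div, div_div, div_div, mul_comm]
  have ha_lim : Tendsto (fun t => V (1 / (1 - s t)) / μ / t) atTop (nhds (lam⁻¹ ^ γ)) := by
    have h1 : Tendsto (fun t => V (1 / (1 - s t)) / V (W (μ * t))) atTop (nhds (lam⁻¹ ^ γ)) :=
      MonotoneOn.tendsto_div_of_regularlyVarying_s10 (T := 2)
        (hVmono.monotoneOn.mono (Set.Ici_subset_Ici.2 one_le_two))
        (fun x hx => hVpos x (one_lt_two.trans_le hx)) hVrv (inv_pos.2 hlam) hWμtop hs_lim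
    refine h1.congr' ?_
    filter_upwards [eventually_ge_atTop 0] with t ht
    rw [hVW _ (mul_nonneg hμ.le ht), div_div]
  have hnum := hquot (fun t => V (1 / (1 - s t)) / μ) s (lam⁻¹ ^ γ) (by positivity)
    (by
      filter_upwards [hs_inv] with t ht
      exact div_nonneg (hVnonneg _ ht) hμ.le) ha_lim
    (by
      filter_upwards [hs_inv, hs_mem] with t ht hst u hu
      have h1 : 0 ≤ V (1 / (1 - s t)) / μ := div_nonneg (hVnonneg _ ht) hμ.le
      rw [hp_eq _ (by positivity), hq u (le_of_lt hu) _ ⟨hst.1.le, hst.2⟩, one_div, mul_add,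
        mul_div_cancel₀ _ hμ.ne'])
  have hfin := hnum.div hden hRpos.ne'
  have hval : (∫ u in Set.Ioi 0, r u) * (1 + lam⁻¹ ^ γ) ^ (-(α / γ)) / (∫ u in Set.Ioi 0, r u)
      = lam ^ α * (1 + lam ^ γ) ^ (-(α / γ)) := by
    rw [mul_div_cancel_left₀ _ hRpos.ne']
    have hl := Real.rpow_pos_of_pos hlam γ
    have h1 : 1 + lam⁻¹ ^ γ = (lam ^ γ)⁻¹ * (1 + lam ^ γ) := by
      rw [Real.inv_rpow hlam.le]
      field_simp
      ring
    rw [h1, Real.mul_rpow (by positivity) (by positivity), ← Real.rpow_neg hlam.le,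
      ← Real.rpow_mul hlam.le]
    congr 2
    field_simp
  rw [hval] at hfin
  refine hfin.congr' ?_
  filter_upwards [eventually_ge_atTop S] with t ht
  exact div_div_div_cancel_right₀ (hp_pos t ht).ne' _ _
end
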